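/- arXiv:math/0309022 — 2 statements merged into one kernel-verified Lean document; each statement's English description precedes it below -/
import Mathlib

section
/- Let z₀ ∈ ∂U. Then K is locally connected at z₀ if and only if for every ζ ∈ ∂𝔻 with z₀ ∈ I(ζ), the point z₀ is strongly minimal in ζ. -/
open Filter Topology Metric Set OnePoint

noncomputable section

local notation "ℂ∞" => OnePoint ℂ

/-- A set `K` is locally connected (connected im kleinen) at a point `z`:
every neighborhood of `z` in `K` contains a connected neighborhood of `z` in `K`. -/
def LocallyConnectedAt {X : Type*} [TopologicalSpace X] (K : Set X) (z : X) : Prop :=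
  ∀ V ∈ 𝓝[K] z, ∃ N ∈ 𝓝[K] z, N ⊆ K ∩ V ∧ IsConnected N

/-- `φ : ℂ → ℂ∞` is holomorphic, as a map into the Riemann sphere, on `D`:
near every point of `D` it is either given by an analytic `ℂ`-valued function, or by the
reciprocal of one. -/
def HolomorphicIntoSphereOn (φ : ℂ → ℂ∞) (D : Set ℂ) : Prop :=
  ∀ z ∈ D,
    (∃ g : ℂ → ℂ, AnalyticAt ℂ g z ∧ ∀ᶠ w in 𝓝 z, φ w = ((g w : ℂ) : ℂ∞)) ∨
    (∃ g : ℂ → ℂ, AnalyticAt ℂ g z ∧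
      ∀ᶠ w in 𝓝 z, φ w = if g w = 0 then (∞ : ℂ∞) else (((g w)⁻¹ : ℂ) : ℂ∞))

/-- The impression of the prime end `ζ ∈ ∂𝔻` (cluster set of `φ` at `ζ`). -/
def impression (φ : ℂ → ℂ∞) (ζ : ℂ) : Set ℂ∞ :=
  {z | ∃ w : ℕ → ℂ, (∀ j, w j ∈ ball (0 : ℂ) 1) ∧ Tendsto w atTop (𝓝 ζ) ∧
    Tendsto (fun j => φ (w j)) atTop (𝓝 z)}

/-- The set of principal points of the prime end `ζ` (radial cluster set of `φ` at `ζ`). -/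
def principalPoints (φ : ℂ → ℂ∞) (ζ : ℂ) : Set ℂ∞ :=
  {z | ∃ t : ℕ → ℝ, (∀ j, t j ∈ Ico (0 : ℝ) 1) ∧ Tendsto t atTop (𝓝 1) ∧
    Tendsto (fun j => φ ((t j : ℂ) * ζ)) atTop (𝓝 z)}

/-- The accumulation set of a curve `Γ : [0,∞) → ℂ∞`: all limits of sequences `Γ (t j)`
with `t j → ∞`. -/
def accSet (Γ : ℝ → ℂ∞) : Set ℂ∞ :=
  {z | ∃ t : ℕ → ℝ, Tendsto t atTop atTop ∧ Tendsto (fun j => Γ (t j)) atTop (𝓝 z)}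

/-- `Γ` is a (continuous) curve `[0,∞) → U`. -/
def IsCurveIn (U : Set ℂ∞) (Γ : ℝ → ℂ∞) : Prop :=
  ContinuousOn Γ (Ici 0) ∧ MapsTo Γ (Ici 0) U

/-- The curve `Γ : [0,∞) → U` converges to the prime end `ζ`: `φ⁻¹(Γ(t)) = ψ(Γ(t)) → ζ`. -/
def ConvergesToPrimeEnd (U : Set ℂ∞) (ψ : ℂ∞ → ℂ) (Γ : ℝ → ℂ∞) (ζ : ℂ) : Prop :=
  IsCurveIn U Γ ∧ Tendsto (fun t => ψ (Γ t)) atTop (𝓝 ζ)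

/-- `Γ` converges to the prime end `ζ` from the left. -/
def ConvergesFromLeft (U : Set ℂ∞) (ψ : ℂ∞ → ℂ) (Γ : ℝ → ℂ∞) (ζ : ℂ) : Prop :=
  ConvergesToPrimeEnd U ψ Γ ζ ∧ ∀ᶠ t in atTop, 0 ≤ (ψ (Γ t) / ζ).im

/-- `Γ` converges to the prime end `ζ` from the right. -/
def ConvergesFromRight (U : Set ℂ∞) (ψ : ℂ∞ → ℂ) (Γ : ℝ → ℂ∞) (ζ : ℂ) : Prop :=
  ConvergesToPrimeEnd U ψ Γ ζ ∧ ∀ᶠ t in atTop, (ψ (Γ t) / ζ).im ≤ 0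

/-- The left wing `I⁺(ζ)` of the prime end `ζ`. -/
def leftWing (U : Set ℂ∞) (ψ : ℂ∞ → ℂ) (ζ : ℂ) : Set ℂ∞ :=
  {z | ∃ Γ : ℝ → ℂ∞, ConvergesFromLeft U ψ Γ ζ ∧ z ∈ accSet Γ}

/-- The right wing `I⁻(ζ)` of the prime end `ζ`. -/
def rightWing (U : Set ℂ∞) (ψ : ℂ∞ → ℂ) (ζ : ℂ) : Set ℂ∞ :=
  {z | ∃ Γ : ℝ → ℂ∞, ConvergesFromRight U ψ Γ ζ ∧ z ∈ accSet Γ}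

/-- `z` has priority over `w` in the left wing of `ζ`. -/
def PriorityLeft (U : Set ℂ∞) (ψ : ℂ∞ → ℂ) (ζ : ℂ) (z w : ℂ∞) : Prop :=
  ∀ Γ : ℝ → ℂ∞, ConvergesFromLeft U ψ Γ ζ → w ∈ accSet Γ → z ∈ accSet Γ

/-- `z` has priority over `w` in the right wing of `ζ`. -/
def PriorityRight (U : Set ℂ∞) (ψ : ℂ∞ → ℂ) (ζ : ℂ) (z w : ℂ∞) : Prop :=
  ∀ Γ : ℝ → ℂ∞, ConvergesFromRight U ψ Γ ζ → w ∈ accSet Γ → z ∈ accSet Γ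

/-- The sequence `w` accumulates at `z` (some subsequence converges to `z`). -/
def SeqAccumAt (w : ℕ → ℂ∞) (z : ℂ∞) : Prop :=
  ∃ n : ℕ → ℕ, StrictMono n ∧ Tendsto (fun j => w (n j)) atTop (𝓝 z)

/-- `z₀` is strongly minimal in the prime end `ζ`: every sequence in `U` converging to the
prime end `ζ` and not accumulating at `z₀` lies on a curve converging to `ζ` whose
accumulation set misses `z₀`. -/
def StronglyMinimal (U : Set ℂ∞) (ψ : ℂ∞ → ℂ) (ζ : ℂ) (z₀ : ℂ∞) : Prop :=
  ∀ w : ℕ → ℂ∞, (∀ j, w j ∈ U) → Tendsto (fun j => ψ (w j)) atTop (𝓝 ζ) →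
    ¬ SeqAccumAt w z₀ →
    ∃ Γ : ℝ → ℂ∞, ConvergesToPrimeEnd U ψ Γ ζ ∧ (∀ j, ∃ t, 0 ≤ t ∧ Γ t = w j) ∧
      z₀ ∉ accSet Γ


lemma log_C (f : ℂ → ℂ) (hf : Continuous f) (h0 : ∀ z, f z ≠ 0) :
    ∃ l : ℂ → ℂ, Continuous l ∧ ∀ z, Complex.exp (l z) = f z := by
  obtain ⟨F, ⟨-, hF⟩, -⟩ := Complex.isCoveringMap_exp.existsUnique_continuousMap_lifts
    (A := ℂ) ⟨fun z => (⟨f z, h0 z⟩ : {z : ℂ // z ≠ 0}), by fun_prop⟩ 0 (Complex.log (f 0))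
    (by ext; simp [Complex.exp_log (h0 0)])
  refine ⟨F, F.continuous, fun z => ?_⟩
  have := congrFun hF z
  simpa using congrArg Subtype.val this

lemma log_ball (f : ℂ → ℂ) (hf : ContinuousOn f (ball 0 1)) (h0 : ∀ z ∈ ball (0 : ℂ) 1, f z ≠ 0) :
    ∃ l : ℂ → ℂ, ContinuousOn l (ball 0 1) ∧ ∀ z ∈ ball (0 : ℂ) 1, Complex.exp (l z) = f z := by
  have hc : Continuous (fun z : ℂ => f (Homeomorph.unitBall z : ball (0 : ℂ) 1)) := by
    have := continuousOn_iff_continuous_domRestrict.1 hf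
    exact this.comp (Homeomorph.unitBall (E := ℂ)).continuous
  obtain ⟨l, hl, hl'⟩ := log_C _ hc (fun z => h0 _ (Homeomorph.unitBall z : ball (0 : ℂ) 1).2)
  classical
  refine ⟨fun z => if h : z ∈ ball (0 : ℂ) 1 then l (Homeomorph.unitBall.symm ⟨z, h⟩) else 0, ?_, ?_⟩
  · rw [continuousOn_iff_continuous_domRestrict]
    refine (hl.comp (Homeomorph.unitBall (E := ℂ)).symm.continuous).congr fun z => ?_
    have := z.2
    simp only [Set.domRestrict_apply, Function.comp]
    rw [dif_pos this]
  · intro z hz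
    simp only []
    rw [dif_pos hz, hl']
    simp

lemma log_diff_const {X : Type*} [TopologicalSpace X] {S : Set X} (hS : IsPreconnected S)
    {l m : X → ℂ} (hl : ContinuousOn l S) (hm : ContinuousOn m S)
    (h : ∀ x ∈ S, Complex.exp (l x) = Complex.exp (m x)) {x y : X} (hx : x ∈ S) (hy : y ∈ S) :
    l x - m x = l y - m y := by
  have key : ∀ x ∈ S, ∃ n : ℤ, (l x - m x) / (2 * Real.pi * Complex.I) = n := by
    intro x hx
    obtain ⟨n, hn⟩ := Complex.exp_eq_exp_iff_exists_int.1 (h x hx)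
    refine ⟨n, ?_⟩
    rw [hn]
    have := Complex.two_pi_I_ne_zero
    field_simp
    ring
  have hc : ContinuousOn (fun x => ((l x - m x) / (2 * Real.pi * Complex.I)).re) S := by
    apply Complex.continuous_re.comp_continuousOn
    exact (hl.sub hm).div_const _
  have hT : DiscreteTopology (Set.range ((↑) : ℤ → ℝ)) := by
    have := (Int.isClosedEmbedding_coe_real).isEmbedding.toHomeomorph
    exact this.symm.isEmbedding.discreteTopology
  have := hS.constant_of_mapsTo ⟨hT⟩ hc (T := Set.range ((↑) : ℤ → ℝ)) (by
    intro z hz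
    obtain ⟨n, hn⟩ := key z hz
    refine ⟨n, ?_⟩
    simp only [hn]; simp) hx hy
  obtain ⟨n, hn⟩ := key x hx
  obtain ⟨k, hk⟩ := key y hy
  simp only [hn, hk] at this
  have h2 := Complex.two_pi_I_ne_zero
  have : (n : ℂ) = k := by exact_mod_cast this
  rw [div_eq_iff h2] at hn hk
  rw [hn, hk, this]

/-- the function (z-x)/(z-y) on the sphere -/
def fr (x y : ℂ) (z : ℂ∞) : ℂ := z.elim 1 (fun z => (z - x) / (z - y))

@[simp] lemma fr_infty (x y : ℂ) : fr x y ∞ = 1 := rfl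
@[simp] lemma fr_coe (x y z : ℂ) : fr x y (z : ℂ∞) = (z - x) / (z - y) := rfl

lemma fr_ne_zero {x y : ℂ} {z : ℂ∞} (hx : z ≠ x) (hy : z ≠ y) : fr x y z ≠ 0 := by
  induction z using OnePoint.rec with
  | infty => simp
  | coe z =>
    have h1 : z ≠ x := fun h => hx (by rw [h])
    have h2 : z ≠ y := fun h => hy (by rw [h])
    simp [sub_ne_zero, h1, h2]

lemma fr_continuousAt {x y : ℂ} {z : ℂ∞} (hy : z ≠ y) : ContinuousAt (fr x y) z := by
  induction z using OnePoint.rec with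
  | infty =>
    rw [continuousAt_infty', coclosedCompact_eq_cocompact]
    have : (fr x y ∘ (↑) : ℂ → ℂ) =ᶠ[cocompact ℂ] fun z => 1 + (y - x) * (z - y)⁻¹ := by
      have : ∀ᶠ z in cocompact ℂ, z ≠ y := by
        have : ({y}ᶜ : Set ℂ) ∈ cocompact ℂ := isCompact_singleton.compl_mem_cocompact
        exact this
      filter_upwards [this] with z hz
      have : z - y ≠ 0 := sub_ne_zero.2 hz
      simp; field_simp; ring
    refine Tendsto.congr' this.symm ?_
    have h1 : Tendsto (fun z : ℂ => z - y) (cocompact ℂ) (cocompact ℂ) :=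
      (Homeomorph.subRight y).isClosedEmbedding.tendsto_cocompact
    have h2 := (Filter.tendsto_inv₀_cobounded (α := ℂ)).comp (h1.trans_eq Metric.cobounded_eq_cocompact.symm)
    have h3 := (h2.const_mul (y - x)).const_add 1
    simpa using h3
  | coe z =>
    have h2 : z ≠ y := fun h => hy (by rw [h])
    rw [continuousAt_coe]
    have : z - y ≠ 0 := sub_ne_zero.2 h2
    change ContinuousAt (fun z => (z - x) / (z - y)) z
    fun_prop (disch := assumption)

def HasLog (A : Set ℂ∞) (f : ℂ∞ → ℂ) : Prop :=
  ∃ l : ℂ∞ → ℂ, ContinuousOn l A ∧ ∀ z ∈ A, Complex.exp (l z) = f z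

/-- no continuous log of `z` on a circle. -/
lemma no_log_circle (R : ℝ) (hR : 0 < R) (m : ℂ → ℂ) (hm : ContinuousOn m (sphere 0 R))
    (h : ∀ z ∈ sphere (0 : ℂ) R, Complex.exp (m z) = z) : False := by
  have hmem : ∀ t : ℝ, (R : ℂ) * Complex.exp (t * Complex.I) ∈ sphere (0 : ℂ) R := by
    intro t
    simp [Complex.norm_exp_ofReal_mul_I, abs_of_pos hR]
  have := log_diff_const (S := (univ : Set ℝ)) isPreconnected_univ
    (l := fun t => m ((R : ℂ) * Complex.exp (t * Complex.I)))
    (m := fun t => Real.log R + t * Complex.I)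
    (by
      apply hm.comp (by fun_prop)
      intro t _
      exact hmem t) (by fun_prop) (by
      intro t _
      rw [h _ (hmem t), Complex.exp_add, ← Complex.ofReal_exp, Real.exp_log hR])
    (mem_univ 0) (mem_univ (2 * Real.pi))
  simp at this

/-- Eilenberg: key lemma. -/
lemma lemmaZ (x y : ℂ) (hxy : x ≠ y) (F : ℂ∞ → ℂ) (hF : Continuous F)
    (h0 : ∀ z : ℂ∞, z ≠ x → F z ≠ 0) (hx : ∀ᶠ z in 𝓝 (x : ℂ∞), F z = fr x y z) : False := by
  let inv : ℂ → ℂ∞ := fun u => if u = 0 then ∞ else ((x + u⁻¹ : ℂ) : ℂ∞)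
  have hinv : Continuous inv := by
    rw [continuous_iff_continuousAt]
    intro u
    by_cases hu : u = 0
    · subst hu
      have : Tendsto inv (𝓝[≠] 0) (𝓝 ∞) := by
        have h1 : Tendsto (fun u : ℂ => x + u⁻¹) (𝓝[≠] 0) (cocompact ℂ) :=
          (Homeomorph.addLeft x).isClosedEmbedding.tendsto_cocompact.comp
            (Filter.tendsto_inv₀_nhdsNE_zero.trans_eq (by rw [Metric.cobounded_eq_cocompact]))
        have h2 : Tendsto ((↑) : ℂ → ℂ∞) (cocompact ℂ) (𝓝 ∞) := by
          have := tendsto_coe_infty (X := ℂ)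
          rwa [coclosedCompact_eq_cocompact] at this
        refine (h2.comp h1).congr' ?_
        filter_upwards [self_mem_nhdsWithin] with u hu
        have : u ≠ 0 := hu
        simp [inv, this]
      rw [continuousAt_iff_punctured_nhds]
      simpa [inv] using this
    · have : ContinuousAt (fun u : ℂ => ((x + u⁻¹ : ℂ) : ℂ∞)) u := by
        apply OnePoint.continuous_coe.continuousAt.comp
        exact continuousAt_const.add (continuousAt_inv₀ hu)
      refine this.congr ?_
      filter_upwards [isOpen_ne.mem_nhds hu] with v hv
      have : v ≠ 0 := hv
      simp [inv, this]
  have hinvx : ∀ u, inv u ≠ x := by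
    intro u
    by_cases hu : u = 0
    · simp [inv, hu]
    · simp [inv, hu]
  obtain ⟨l, hl, hl'⟩ := log_C (fun u => F (inv u)) (hF.comp hinv) (fun u => h0 _ (hinvx u))
  rw [OnePoint.nhds_coe_eq, eventually_map, Metric.eventually_nhds_iff] at hx
  obtain ⟨ε, hε, hx⟩ := hx
  have hd : 0 < ‖x - y‖ := norm_pos_iff.2 (sub_ne_zero.2 hxy)
  obtain ⟨R, hR0, hR1, hR2⟩ : ∃ R : ℝ, 0 < R ∧ R⁻¹ < ε ∧ R⁻¹ < ‖x - y‖ := by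
    refine ⟨(min ε ‖x - y‖ / 2)⁻¹, by positivity, ?_, ?_⟩
    · rw [inv_inv]; have := min_le_left ε ‖x - y‖; linarith
    · rw [inv_inv]; have := min_le_right ε ‖x - y‖; linarith
  refine no_log_circle R hR0 (fun u => - l u - Complex.log (1 + u⁻¹ / (x - y)) - Complex.log (x - y)) ?_ ?_
  · have hne : ∀ u ∈ sphere (0 : ℂ) R, u ≠ 0 := by
      intro u hu h
      simp [h] at hu
      linarith
    have : ∀ u ∈ sphere (0 : ℂ) R, 1 + u⁻¹ / (x - y) ∈ Complex.slitPlane := by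
      intro u hu
      apply Complex.mem_slitPlane_of_norm_lt_one
      simp only [mem_sphere_zero_iff_norm] at hu
      rw [norm_div, norm_inv, hu, div_lt_one hd]
      exact hR2
    refine ((hl.neg.continuousOn).sub (ContinuousOn.clog ?_ this)).sub continuousOn_const
    exact continuousOn_const.add ((continuousOn_id.inv₀ hne).div_const _)
  · intro u hu
    have hu0 : u ≠ 0 := by
      intro h
      simp [h] at hu
      linarith
    simp only [mem_sphere_zero_iff_norm] at hu
    have h1 : 1 + u⁻¹ / (x - y) ≠ 0 := by
      apply Complex.slitPlane_ne_zero
      apply Complex.mem_slitPlane_of_norm_lt_one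
      rw [norm_div, norm_inv, hu, div_lt_one hd]
      exact hR2
    have hxy' := sub_ne_zero.2 hxy
    rw [Complex.exp_sub, Complex.exp_sub, Complex.exp_neg, Complex.exp_log hxy', Complex.exp_log h1, hl']
    have h3 : inv u = ((x + u⁻¹ : ℂ) : ℂ∞) := by simp [inv, hu0]
    rw [h3, hx (by simp [hu]; simpa using hR1)]
    have h4 : x + u⁻¹ - y = (1 + u⁻¹ / (x - y)) * (x - y) := by field_simp; ring
    rw [fr_coe, h4]
    simp only [add_sub_cancel_left]
    have h5 : x - y + u⁻¹ ≠ 0 := by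
      have : x - y + u⁻¹ = (1 + u⁻¹ / (x - y)) * (x - y) := by field_simp
      rw [this]; exact mul_ne_zero h1 hxy'
    have h6 : u * (x - y) + 1 ≠ 0 := by
      have : u * (x - y) + 1 = u * (x - y + u⁻¹) := by field_simp
      rw [this]; exact mul_ne_zero hu0 h5
    field_simp

lemma lemmaS (x y : ℂ) (V : Set ℂ∞) (hV : IsOpen V) (hx : (x : ℂ∞) ∈ V) (hy : (y : ℂ∞) ∉ closure V)
    (h : HasLog (frontier V) (fr x y)) : False := by
  obtain ⟨l, hl, hl'⟩ := h
  have hxy : x ≠ y := by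
    rintro rfl
    exact hy (subset_closure hx)
  obtain ⟨L, hL⟩ := ContinuousMap.exists_restrict_eq (Y := ℂ) (isClosed_frontier (s := V))
    ⟨(frontier V).domRestrict l, continuousOn_iff_continuous_domRestrict.1 hl⟩
  have hL' : ∀ z ∈ frontier V, L z = l z := by
    intro z hz
    have := congrArg (fun f => f ⟨z, hz⟩) hL
    exact this
  classical
  let F : ℂ∞ → ℂ := fun z => if z ∈ V then fr x y z else Complex.exp (L z)
  refine lemmaZ x y hxy F ?_ ?_ ?_
  · refine continuous_if ?_ ?_ ?_
    · intro z hz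
      have hz' : z ∈ frontier V := hz
      rw [hL' z hz', hl' z hz']
    · intro z hz
      exact (fr_continuousAt (by rintro rfl; exact hy hz)).continuousWithinAt
    · exact (Complex.continuous_exp.comp L.continuous).continuousOn
  · intro z hz
    by_cases hzV : z ∈ V
    · simp only [F, hzV, if_true]
      exact fr_ne_zero hz (by rintro rfl; exact hy (subset_closure hzV))
    · simp only [F, hzV, if_false]
      exact Complex.exp_ne_zero _
  · filter_upwards [hV.mem_nhds hx] with z hz
    simp [F, hz]

lemma contOn_coe {l : ℂ∞ → ℂ} {S : Set ℂ} (h : ContinuousOn (fun z : ℂ => l z) S) :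
    ContinuousOn l ((↑) '' S : Set ℂ∞) := by
  rintro _ ⟨z, hz, rfl⟩
  unfold ContinuousWithinAt
  rw [OnePoint.nhdsWithin_coe_image, tendsto_map'_iff]
  exact h z hz

lemma fr_slit {s t : ℂ} {z : ℂ∞} (h : ∀ u : ℂ, z = u → ‖t - s‖ < ‖u - t‖) :
    fr s t z ∈ Complex.slitPlane := by
  induction z using OnePoint.rec with
  | infty => simp
  | coe z =>
    have h1 := h z rfl
    have h2 : 0 < ‖z - t‖ := lt_of_le_of_lt (norm_nonneg _) h1
    have h3 : z - t ≠ 0 := norm_pos_iff.1 h2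
    have : fr s t z = 1 + (t - s) / (z - t) := by
      rw [fr_coe]; field_simp; ring
    rw [this]
    apply Complex.mem_slitPlane_of_norm_lt_one
    rw [norm_div, div_lt_one h2]
    exact h1

lemma fr_slit_cont {s t : ℂ} {z : ℂ∞} (h : ∀ u : ℂ, z = u → ‖t - s‖ < ‖u - t‖) :
    ContinuousAt (fun z => Complex.log (fr s t z)) z := by
  refine ContinuousAt.clog (fr_continuousAt ?_) (fr_slit h)
  rintro rfl
  have := h t rfl
  simp at this
  linarith [norm_nonneg (t - s)]

lemma HasLog.congr {A : Set ℂ∞} {f g : ℂ∞ → ℂ} (h : HasLog A f) (hfg : ∀ z ∈ A, f z = g z) :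
    HasLog A g := by
  obtain ⟨l, hl, hl'⟩ := h
  exact ⟨l, hl, fun z hz => by rw [hl' z hz, hfg z hz]⟩

lemma HasLog.mul {A : Set ℂ∞} {f g : ℂ∞ → ℂ} (h : HasLog A f) (h' : HasLog A g) :
    HasLog A (fun z => f z * g z) := by
  obtain ⟨l, hl, hl'⟩ := h
  obtain ⟨m, hm, hm'⟩ := h'
  exact ⟨fun z => l z + m z, hl.add hm, fun z hz => by rw [Complex.exp_add, hl' z hz, hm' z hz]⟩

lemma HasLog.inv {A : Set ℂ∞} {f : ℂ∞ → ℂ} (h : HasLog A f) :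
    HasLog A (fun z => (f z)⁻¹) := by
  obtain ⟨l, hl, hl'⟩ := h
  exact ⟨fun z => - l z, hl.neg, fun z hz => by rw [Complex.exp_neg, hl' z hz]⟩

lemma HasLog.mono {A B : Set ℂ∞} {f : ℂ∞ → ℂ} (h : HasLog A f) (hB : B ⊆ A) : HasLog B f := by
  obtain ⟨l, hl, hl'⟩ := h
  exact ⟨l, hl.mono hB, fun z hz => hl' z (hB hz)⟩

lemma hasLog_of_conn {A : Set ℂ∞} (hA : IsClosed A) {V : Set ℂ} (hV : IsPreconnected V)
    (hVA : ∀ v ∈ V, (v : ℂ∞) ∉ A) {x y : ℂ} (hx : x ∈ V) (hy : y ∈ V) : HasLog A (fr x y) := by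
  refine hV.induction₂ (fun x y => HasLog A (fr x y)) ?_ ?_ ?_ hx hy
  · intro s hs
    have h1 : ∀ᶠ t : ℂ in 𝓝 s, (t : ℂ∞) ∉ A := by
      have : Aᶜ ∈ 𝓝 (s : ℂ∞) := hA.isOpen_compl.mem_nhds (hVA s hs)
      exact OnePoint.continuous_coe.continuousAt this
    rw [Metric.eventually_nhds_iff] at h1
    obtain ⟨e, he, h1⟩ := h1
    apply mem_nhdsWithin_of_mem_nhds
    filter_upwards [Metric.ball_mem_nhds s (half_pos he)] with t ht
    have hsl : ∀ z ∈ A, ∀ u : ℂ, z = u → ‖t - s‖ < ‖u - t‖ := by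
      rintro z hz u rfl
      by_contra hcon
      push Not at hcon
      rw [mem_ball, dist_eq_norm] at ht
      refine h1 (y := u) ?_ hz
      rw [dist_eq_norm]
      calc ‖u - s‖ ≤ ‖u - t‖ + ‖t - s‖ := norm_sub_le_norm_sub_add_norm_sub _ _ _
        _ < e := by linarith
    refine ⟨fun z => Complex.log (fr s t z), fun z hz => (fr_slit_cont (hsl z hz)).continuousWithinAt,
      fun z hz => Complex.exp_log (Complex.slitPlane_ne_zero (fr_slit (hsl z hz)))⟩
  · intro x y z hx hy hz h1 h2
    refine (h1.mul h2).congr ?_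
    intro w hw
    induction w using OnePoint.rec with
    | infty => simp
    | coe w =>
      have : w - y ≠ 0 := by
        intro h
        rw [sub_eq_zero] at h
        exact hVA y hy (h ▸ hw)
      simp only [fr_coe]
      field_simp
  · intro x y hx hy h
    refine h.inv.congr ?_
    intro w hw
    induction w using OnePoint.rec with
    | infty => simp
    | coe w => simp

lemma hasLog_ball {c : ℂ} {r : ℝ} {x y : ℂ} (hx : x ∉ closedBall c r) (hy : y ∉ closedBall c r)
    (hr : 0 ≤ r) : HasLog ((↑) '' closedBall c r) (fr x y) := by
  have key : ∀ x : ℂ, x ∉ closedBall c r → c - x ≠ 0 ∧ ∀ z ∈ closedBall c r,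
      1 + (z - c) / (c - x) ∈ Complex.slitPlane := by
    intro x hx
    rw [mem_closedBall, not_le, dist_comm, dist_eq_norm] at hx
    have h0 : 0 < ‖c - x‖ := lt_of_le_of_lt hr hx
    refine ⟨norm_pos_iff.1 h0, fun z hz => ?_⟩
    apply Complex.mem_slitPlane_of_norm_lt_one
    rw [norm_div, div_lt_one h0]
    rw [mem_closedBall, dist_eq_norm] at hz
    linarith
  obtain ⟨hx0, hx1⟩ := key x hx
  obtain ⟨hy0, hy1⟩ := key y hy
  refine ⟨fun z => z.elim 0 (fun z => Complex.log (1 + (z - c) / (c - x))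
    - Complex.log (1 + (z - c) / (c - y)) + Complex.log (c - x) - Complex.log (c - y)), ?_, ?_⟩
  · apply contOn_coe
    simp only [OnePoint.elim_some]
    refine ((ContinuousOn.sub (ContinuousOn.clog ?_ hx1) (ContinuousOn.clog ?_ hy1)).add
      continuousOn_const).sub continuousOn_const <;> fun_prop
  · rintro _ ⟨z, hz, rfl⟩
    have h1 := Complex.slitPlane_ne_zero (hx1 z hz)
    have h2 := Complex.slitPlane_ne_zero (hy1 z hz)
    simp only [OnePoint.elim_some, fr_coe]
    rw [Complex.exp_sub, Complex.exp_add, Complex.exp_sub, Complex.exp_log h1, Complex.exp_log h2,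
      Complex.exp_log hx0, Complex.exp_log hy0]
    have e1 : z - x = (1 + (z - c) / (c - x)) * (c - x) := by field_simp; ring
    have e2 : z - y = (1 + (z - c) / (c - y)) * (c - y) := by field_simp; ring
    rw [e1, e2, div_mul_eq_mul_div, div_div]

lemma HasLog.glue {A B : Set ℂ∞} (hA : IsClosed A) (hB : IsClosed B) {f : ℂ∞ → ℂ}
    (h : HasLog A f) (h' : HasLog B f) (hAB : IsPreconnected (A ∩ B)) : HasLog (A ∪ B) f := by
  obtain ⟨l, hl, hl'⟩ := h
  obtain ⟨m, hm, hm'⟩ := h'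
  classical
  obtain ⟨k, hk, hk'⟩ : ∃ k : ℂ, Complex.exp k = 1 ∧ ∀ z ∈ A ∩ B, l z = m z + k := by
    rcases (A ∩ B).eq_empty_or_nonempty with he | ⟨p, hp⟩
    · exact ⟨0, by simp, by simp [he]⟩
    · have he : ∀ z ∈ A ∩ B, Complex.exp (l z) = Complex.exp (m z) := fun z hz => by
        rw [hl' z hz.1, hm' z hz.2]
      refine ⟨l p - m p, ?_, ?_⟩
      · rw [Complex.exp_sub, he p hp, div_self (Complex.exp_ne_zero _)]
      · intro z hz
        have := log_diff_const hAB (hl.mono inter_subset_left) (hm.mono inter_subset_right) he hz hp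
        rw [← this]; ring
  refine ⟨fun z => if z ∈ A then l z else m z + k, ?_, ?_⟩
  · refine ContinuousOn.union_of_isClosed ?_ ?_ hA hB
    · exact hl.congr fun z hz => by simp [hz]
    · refine (hm.add (continuousOn_const (c := k))).congr fun z hz => ?_
      by_cases hzA : z ∈ A
      · simp [hzA, hk' z ⟨hzA, hz⟩]
      · simp [hzA]
  · rintro z hz
    by_cases hzA : z ∈ A
    · simp [hzA, hl' z hzA]
    · have : z ∈ B := hz.resolve_left hzA
      simp [hzA, Complex.exp_add, hk, hm' z this]

structure RM (U : Set ℂ∞) (φ : ℂ → ℂ∞) (ψ : ℂ∞ → ℂ) : Prop where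
  op : IsOpen U
  inf : ∞ ∈ U
  φc : ContinuousOn φ (ball (0 : ℂ) 1)
  φm : MapsTo φ (ball (0 : ℂ) 1) U
  ψc : ContinuousOn ψ U
  ψm : MapsTo ψ U (ball (0 : ℂ) 1)
  ψφ : ∀ z ∈ ball (0 : ℂ) 1, ψ (φ z) = z
  φψ : ∀ w ∈ U, φ (ψ w) = w

lemma RM.join {U : Set ℂ∞} {φ : ℂ → ℂ∞} {ψ : ℂ∞ → ℂ} (h : RM U φ ψ) {X : Set ℂ∞}
    (hX : IsClosed X) (hUX : Uᶜ ⊆ X) {x y : ℂ} (hx : (x : ℂ∞) ∉ X) (hy : (y : ℂ∞) ∉ X)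
    (hlog : HasLog X (fr x y)) :
    JoinedIn {z | z ∈ ball (0 : ℂ) 1 ∧ φ z ∉ X} (ψ x) (ψ y) := by
  have hXU : ∀ z : ℂ∞, z ∉ X → z ∈ U := fun z hz => by
    by_contra hc; exact hz (hUX hc)
  set G := {z | z ∈ ball (0 : ℂ) 1 ∧ φ z ∉ X} with hG
  have hGo : IsOpen G := h.φc.isOpen_inter_preimage isOpen_ball hX.isOpen_compl
  have hGm : ∀ z : ℂ∞, z ∉ X → ψ z ∈ G := fun z hz =>
    ⟨h.ψm (hXU z hz), by rw [h.φψ z (hXU z hz)]; exact hz⟩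
  have hVo : ∀ p, IsOpen (U ∩ ψ ⁻¹' connectedComponentIn G p) := fun p =>
    h.ψc.isOpen_inter_preimage h.op hGo.connectedComponentIn
  set C := connectedComponentIn G (ψ x) with hC
  set V := U ∩ ψ ⁻¹' C with hV
  have hxG := hGm x hx
  have hyG := hGm y hy
  have hfr : ∀ z ∈ closure V, z ∉ X → z ∈ V := by
    intro z hz hzX
    have h1 := hVo (ψ z)
    have h2 : z ∈ U ∩ ψ ⁻¹' connectedComponentIn G (ψ z) :=
      ⟨hXU z hzX, mem_connectedComponentIn (hGm z hzX)⟩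
    obtain ⟨w, hw1, hw2⟩ := mem_closure_iff.1 hz _ h1 h2
    have e1 := connectedComponentIn_eq hw1.2
    have e2 := connectedComponentIn_eq hw2.2
    refine ⟨hXU z hzX, ?_⟩
    change ψ z ∈ C
    rw [hC, e2, ← e1]
    exact mem_connectedComponentIn (hGm z hzX)
  have hyC : ψ y ∈ C := by
    by_contra hyC
    refine lemmaS x y V (hVo _) ⟨hXU _ hx, mem_connectedComponentIn hxG⟩ ?_ ?_
    · intro hc
      exact hyC (hfr _ hc hy).2
    · refine hlog.mono ?_
      intro z hz
      by_contra hzX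
      rw [frontier, (hVo _).interior_eq] at hz
      exact hz.2 (hfr z hz.1 hzX)
  have hCc : IsPathConnected C := by
    rw [← hGo.connectedComponentIn.isConnected_iff_isPathConnected]
    exact isConnected_connectedComponentIn_iff.2 hxG
  exact (hCc.joinedIn _ (mem_connectedComponentIn hxG) _ hyC).mono (connectedComponentIn_subset _ _)

lemma det_mul (c : ℂ) : ((c • (1 : ℂ →L[ℝ] ℂ)) : ℂ →L[ℝ] ℂ).det = ‖c‖ ^ 2 := by
  have h1 : ((c • (1 : ℂ →L[ℝ] ℂ) : ℂ →L[ℝ] ℂ) : ℂ →ₗ[ℝ] ℂ) = Algebra.lmul ℝ ℂ c := by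
    ext; simp
  rw [ContinuousLinearMap.det, h1, ← Algebra.norm_apply, Algebra.norm_complex_apply,
    Complex.normSq_eq_norm_sq]

/-- slice estimate -/
lemma slice_est {h : ℂ → ℂ} {Ω : Set ℂ} (hΩ : IsOpen Ω) (hd : DifferentiableOn ℂ h Ω)
    {s t1 t2 ε : ℝ} (hε : 0 < ε) (ht : t1 ≤ t2) (htp : t2 - t1 ≤ Real.pi)
    (hmem : ∀ t ∈ Icc t1 t2, (s + t * Complex.I : ℂ) ∈ Ω)
    (hgt : ε < ‖h (s + t2 * Complex.I) - h (s + t1 * Complex.I)‖) :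
    ENNReal.ofReal (ε ^ 2 / Real.pi) ≤
      ∫⁻ t : ℝ, Ω.indicator (fun u => ENNReal.ofReal (‖deriv h u‖ ^ 2)) (s + t * Complex.I) := by
  have hpi := Real.pi_pos
  have hdc : ContinuousOn (deriv h) Ω := (hd.deriv hΩ).continuousOn
  have hcont : ContinuousOn (fun t : ℝ => deriv h (s + t * Complex.I)) (Icc t1 t2) := by
    refine hdc.comp (by fun_prop) hmem
  have hFTC := intervalIntegral.integral_eq_sub_of_hasDerivAt (a := t1) (b := t2)
    (f := fun t : ℝ => h (s + t * Complex.I)) (f' := fun t : ℝ => deriv h (s + t * Complex.I) * Complex.I)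
    (by
      intro t htt
      rw [uIcc_of_le ht] at htt
      have h1 : HasDerivAt h (deriv h (s + t * Complex.I)) (s + t * Complex.I) :=
        (hd.differentiableAt (hΩ.mem_nhds (hmem t htt))).hasDerivAt
      have h2 : HasDerivAt (fun u : ℂ => (s : ℂ) + u * Complex.I) (Complex.I) (t : ℂ) := by
        simpa using ((hasDerivAt_id (t : ℂ)).mul_const Complex.I).const_add (s : ℂ)
      exact (HasDerivAt.comp (t : ℂ) h1 h2).comp_ofReal)
    (by
      apply ContinuousOn.intervalIntegrable
      rw [uIcc_of_le ht]
      exact hcont.mul continuousOn_const)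
  have hi1 : IntervalIntegrable (fun t : ℝ => ‖deriv h (s + t * Complex.I)‖) MeasureTheory.volume t1 t2 := by
    apply ContinuousOn.intervalIntegrable
    rw [uIcc_of_le ht]
    exact hcont.norm
  have hi2 : IntervalIntegrable (fun t : ℝ => ‖deriv h (s + t * Complex.I)‖ ^ 2) MeasureTheory.volume t1 t2 := by
    apply ContinuousOn.intervalIntegrable
    rw [uIcc_of_le ht]
    exact hcont.norm.pow 2
  have hb : ε < ∫ t in t1..t2, ‖deriv h (s + t * Complex.I)‖ := by
    rw [← hFTC] at hgt
    refine hgt.trans_le ((intervalIntegral.norm_integral_le_integral_norm ht).trans_eq ?_)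
    simp
  have hb2 : ∫ t in t1..t2, ‖deriv h (s + t * Complex.I)‖ ≤
      ∫ t in t1..t2, (ε / (2 * Real.pi) + Real.pi / (2 * ε) * ‖deriv h (s + t * Complex.I)‖ ^ 2) := by
    apply intervalIntegral.integral_mono_on ht hi1
    · exact (intervalIntegrable_const).add (hi2.const_mul _)
    · intro t _
      set a := ‖deriv h (s + t * Complex.I)‖
      have : ε / (2 * Real.pi) + Real.pi / (2 * ε) * a ^ 2 - a
          = (ε - Real.pi * a) ^ 2 / (2 * Real.pi * ε) := by
        field_simp; ring
      have h2 : 0 ≤ (ε - Real.pi * a) ^ 2 / (2 * Real.pi * ε) := by positivity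
      linarith
  rw [intervalIntegral.integral_add intervalIntegrable_const (hi2.const_mul _),
    intervalIntegral.integral_const, intervalIntegral.integral_const_mul, smul_eq_mul] at hb2
  set I2 := ∫ t in t1..t2, ‖deriv h (s + t * Complex.I)‖ ^ 2 with hI2
  have h3 : (t2 - t1) * (ε / (2 * Real.pi)) ≤ ε / 2 := by
    calc (t2 - t1) * (ε / (2 * Real.pi)) ≤ Real.pi * (ε / (2 * Real.pi)) := by gcongr
      _ = ε / 2 := by field_simp
  have h4 : ε ^ 2 / Real.pi ≤ I2 := by
    have : ε / 2 ≤ Real.pi / (2 * ε) * I2 := by linarith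
    rw [div_le_iff₀ hpi]
    have h5 : Real.pi / (2 * ε) * I2 = (I2 * Real.pi) / (2 * ε) := by ring
    rw [h5, le_div_iff₀ (by positivity)] at this
    nlinarith
  refine (ENNReal.ofReal_le_ofReal h4).trans ?_
  rw [hI2, intervalIntegral.integral_of_le ht,
    MeasureTheory.ofReal_integral_eq_lintegral_ofReal hi2.1 (MeasureTheory.ae_of_all _ fun _ => by positivity)]
  rw [← MeasureTheory.lintegral_indicator measurableSet_Ioc]
  apply MeasureTheory.lintegral_mono
  intro t
  by_cases htt : t ∈ Ioc t1 t2
  · simp only [indicator_of_mem htt, indicator_of_mem (hmem t (Ioc_subset_Icc_self htt))]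
    exact le_rfl
  · simp [indicator_of_notMem htt]

lemma area_slice {h : ℂ → ℂ} {Ω : Set ℂ} (hΩ : IsOpen Ω) (hd : DifferentiableOn ℂ h Ω)
    (hi : InjOn h Ω) {M : ℝ} (hM : MapsTo h Ω (ball 0 M)) {c : ENNReal} (hc : c ≠ 0) {s0 : ℝ}
    (hs : ∀ s < s0, c ≤ ∫⁻ t : ℝ, Ω.indicator (fun u => ENNReal.ofReal (‖deriv h u‖ ^ 2)) (s + t * Complex.I)) :
    False := by
  set w := Ω.indicator (fun u => ENNReal.ofReal (‖deriv h u‖ ^ 2)) with hw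
  have hwm : Measurable w := by
    refine Measurable.indicator ?_ hΩ.measurableSet
    have := measurable_deriv h
    fun_prop
  have h1 : ∫⁻ u, w u < ⊤ := by
    rw [hw, MeasureTheory.lintegral_indicator hΩ.measurableSet]
    have := MeasureTheory.lintegral_abs_det_fderiv_eq_addHaar_image MeasureTheory.volume
      hΩ.measurableSet (f := h) (f' := fun u => deriv h u • (1 : ℂ →L[ℝ] ℂ)) (by
        intro u hu
        have h1 : HasDerivAt h (deriv h u) u := (hd.differentiableAt (hΩ.mem_nhds hu)).hasDerivAt
        exact h1.complexToReal_fderiv.hasFDerivWithinAt) hi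
    simp only [det_mul, abs_pow, abs_norm] at this
    rw [this]
    calc _ ≤ MeasureTheory.volume (ball (0 : ℂ) M) := MeasureTheory.measure_mono hM.image_subset
      _ < ⊤ := MeasureTheory.measure_ball_lt_top
  rw [← (Complex.volume_preserving_equiv_real_prod.symm).lintegral_comp hwm,
    MeasureTheory.Measure.volume_eq_prod, MeasureTheory.lintegral_prod] at h1
  · refine absurd h1 (not_lt.2 ?_)
    have h2 : ∫⁻ s : ℝ in Iio s0, c ≤ ∫⁻ s : ℝ, ∫⁻ t : ℝ, w (Complex.measurableEquivRealProd.symm (s, t)) := by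
      rw [← MeasureTheory.lintegral_indicator measurableSet_Iio]
      apply MeasureTheory.lintegral_mono
      intro s
      by_cases hss : s ∈ Iio s0
      · simp only [indicator_of_mem hss]
        refine (hs s hss).trans_eq ?_
        congr 1
        ext t
        congr 1
        exact (Complex.mk_eq_add_mul_I s t).symm
      · simp [indicator_of_notMem hss]
    refine le_trans ?_ h2
    simp [hc]
  · exact (hwm.comp Complex.measurableEquivRealProd.symm.measurable).aemeasurable

lemma exp_norm_sq (u : ℂ) : ‖1 - Complex.exp u‖ ^ 2
    = 1 - 2 * Real.exp u.re * Real.cos u.im + Real.exp u.re ^ 2 := by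
  rw [← Complex.normSq_eq_norm_sq, Complex.normSq_apply]
  simp only [Complex.sub_re, Complex.one_re, Complex.sub_im, Complex.one_im, Complex.exp_re, Complex.exp_im]
  nlinarith [Real.sin_sq_add_cos_sq u.im]

lemma length_area (g : ℂ → ℂ) (ζ : ℂ) (hζ : ‖ζ‖ = 1) {η : ℝ} (hη : 0 < η)
    (hd : DifferentiableOn ℂ g (ball 0 1 ∩ ball ζ η)) (hi : InjOn g (ball 0 1 ∩ ball ζ η))
    {M : ℝ} (hM : MapsTo g (ball 0 1 ∩ ball ζ η) (ball 0 M)) {ε : ℝ} (hε : 0 < ε) :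
    ∃ ρ, 0 < ρ ∧ ρ < η ∧ ∀ z ∈ ball (0 : ℂ) 1, ∀ z' ∈ ball (0 : ℂ) 1, dist z ζ = ρ → dist z' ζ = ρ →
      dist (g z) (g z') ≤ ε := by
  by_contra hcon
  push Not at hcon
  have hζ0 : ζ ≠ 0 := by rw [← norm_pos_iff, hζ]; exact one_pos
  let Ω : Set ℂ := {u | u.re < Real.log η ∧ u.im ∈ Ioo (-(Real.pi / 2)) (Real.pi / 2) ∧
    Real.exp u.re / 2 < Real.cos u.im}
  have hΩ : IsOpen Ω := by
    refine (isOpen_lt Complex.continuous_re continuous_const).inter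
      ((isOpen_Ioo.preimage Complex.continuous_im).inter ?_)
    exact isOpen_lt (f := fun u : ℂ => Real.exp u.re / 2) (g := fun u : ℂ => Real.cos u.im)
      ((Real.continuous_exp.comp Complex.continuous_re).div_const _) (Real.continuous_cos.comp Complex.continuous_im)
  let e : ℂ → ℂ := fun u => ζ * (1 - Complex.exp u)
  have he : MapsTo e Ω (ball 0 1 ∩ ball ζ η) := by
    rintro u ⟨h1, h2, h3⟩
    constructor
    · simp only [mem_ball_zero_iff, e, norm_mul, hζ, one_mul]
      have := exp_norm_sq u
      have hp := Real.exp_pos u.re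
      nlinarith [norm_nonneg (1 - Complex.exp u)]
    · simp only [mem_ball, dist_eq_norm, e]
      have : ζ * (1 - Complex.exp u) - ζ = - (ζ * Complex.exp u) := by ring
      rw [this, norm_neg, norm_mul, hζ, one_mul, Complex.norm_exp]
      exact (Real.lt_log_iff_exp_lt hη).1 h1
  have hei : InjOn e Ω := by
    rintro u ⟨-, h2, -⟩ v ⟨-, k2, -⟩ huv
    have : Complex.exp u = Complex.exp v := by
      have := mul_left_cancel₀ hζ0 huv
      linear_combination -this
    have hpi := Real.pi_pos
    rw [← Complex.log_exp (x := u) (by linarith [h2.1]) (by linarith [h2.2]), this,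
      Complex.log_exp (by linarith [k2.1]) (by linarith [k2.2])]
  have hed : Differentiable ℂ e := by
    intro u; fun_prop
  -- lifting of points
  have hlift : ∀ s < Real.log η, ∀ z ∈ ball (0 : ℂ) 1, dist z ζ = Real.exp s →
      ∃ t : ℝ, (s + t * Complex.I : ℂ) ∈ Ω ∧ e (s + t * Complex.I) = z := by
    intro s hs z hz hzs
    rw [mem_ball_zero_iff] at hz
    set v := 1 - z / ζ with hv
    have hvn : ‖v‖ = Real.exp s := by
      have : v = (ζ - z) / ζ := by rw [hv]; field_simp
      rw [this, norm_div, hζ, div_one, ← hzs, dist_comm, dist_eq_norm]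
    have hv0 : v ≠ 0 := by rw [← norm_pos_iff, hvn]; exact Real.exp_pos s
    have hre : (Complex.log v).re = s := by rw [Complex.log_re, hvn, Real.log_exp]
    have hul : (s + (Complex.log v).im * Complex.I : ℂ) = Complex.log v := by
      conv_rhs => rw [← Complex.re_add_im (Complex.log v), hre]
    have hez : e (Complex.log v) = z := by
      simp only [e]
      rw [Complex.exp_log hv0, hv]; field_simp; ring
    have hzn : ‖1 - Complex.exp (Complex.log v)‖ < 1 := by
      rw [Complex.exp_log hv0, hv]
      simp only [sub_sub_cancel, norm_div, hζ, div_one]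
      exact hz
    have hcos : Real.exp s / 2 < Real.cos (Complex.log v).im := by
      have h1 := exp_norm_sq (Complex.log v)
      rw [hre] at h1
      have hp := Real.exp_pos s
      have h2 : ‖1 - Complex.exp (Complex.log v)‖ ^ 2 < 1 := by
        nlinarith [norm_nonneg (1 - Complex.exp (Complex.log v))]
      rw [h1] at h2
      by_contra hc
      push Not at hc
      nlinarith
    refine ⟨(Complex.log v).im, ?_, ?_⟩
    · rw [hul]
      refine ⟨by rw [hre]; exact hs, ?_, by rw [hre]; exact hcos⟩
      have : |v.arg| < Real.pi / 2 := by
        rw [Complex.abs_arg_lt_pi_div_two_iff]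
        left
        have h1 : ‖z / ζ‖ < 1 := by rw [norm_div, hζ, div_one]; exact hz
        have h2 := (abs_le.1 (Complex.abs_re_le_norm (z / ζ))).2
        simp only [hv, Complex.sub_re, Complex.one_re]
        linarith
      rw [Complex.log_im]
      exact abs_lt.1 this
    · rw [hul, hez]
  have hconv : ∀ s < Real.log η, ∀ t1 t2 : ℝ, (s + t1 * Complex.I : ℂ) ∈ Ω → (s + t2 * Complex.I : ℂ) ∈ Ω →
      ∀ t ∈ Icc t1 t2, (s + t * Complex.I : ℂ) ∈ Ω := by
    intro s hs t1 t2 h1 h2 t ht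
    have hc := (strictConcaveOn_cos_Icc.concaveOn.convex_gt (Real.exp s / 2)).ordConnected
    simp only [Ω, mem_ofPred_eq, Complex.add_re, Complex.ofReal_re, Complex.mul_re, Complex.I_re,
      mul_zero, Complex.ofReal_im, Complex.I_im, mul_one, sub_self, add_zero, Complex.add_im,
      Complex.mul_im, zero_add] at h1 h2 ⊢
    have := hc.out ⟨Ioo_subset_Icc_self h1.2.1, h1.2.2⟩ ⟨Ioo_subset_Icc_self h2.2.1, h2.2.2⟩ ht
    exact ⟨hs, ⟨lt_of_lt_of_le h1.2.1.1 ht.1, lt_of_le_of_lt ht.2 h2.2.1.2⟩, this.2⟩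
  refine area_slice (h := g ∘ e) hΩ (hd.comp hed.differentiableOn he) (hi.comp hei he) (M := M)
    (hM.comp he) (c := ENNReal.ofReal (ε ^ 2 / Real.pi)) ?_ (s0 := Real.log η) ?_
  · have := Real.pi_pos
    simp only [ne_eq, ENNReal.ofReal_eq_zero, not_le]; positivity
  · intro s hs
    obtain ⟨z, hz, z', hz', hzd, hzd', hgt⟩ := hcon (Real.exp s) (Real.exp_pos s)
      ((Real.lt_log_iff_exp_lt hη).1 hs)
    obtain ⟨t, ht, hte⟩ := hlift s hs z hz hzd
    obtain ⟨t', ht', hte'⟩ := hlift s hs z' hz' hzd'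
    have hlen : ∀ t t' : ℝ, (s + t * Complex.I : ℂ) ∈ Ω → (s + t' * Complex.I : ℂ) ∈ Ω →
        t' - t ≤ Real.pi := by
      intro t t' h1 h2
      have a1 := h1.2.1.1
      have a2 := h2.2.1.2
      simp at a1 a2
      linarith
    rcases le_total t t' with htt | htt
    · refine slice_est hΩ (hd.comp hed.differentiableOn he) hε htt (hlen _ _ ht ht') (hconv s hs t t' ht ht') ?_
      simp only [Function.comp, hte, hte']
      rw [← dist_eq_norm, dist_comm]; exact hgt
    · refine slice_est hΩ (hd.comp hed.differentiableOn he) hε htt (hlen _ _ ht' ht) (hconv s hs t' t ht' ht) ?_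
      simp only [Function.comp, hte, hte']
      rw [← dist_eq_norm]; exact hgt

lemma joined_ball {G : Set ℂ} {a b ζ : ℂ} {ρ : ℝ} (h : JoinedIn G a b) (hG : ∀ z ∈ G, dist z ζ ≠ ρ)
    (ha : dist a ζ < ρ) : JoinedIn (G ∩ ball ζ ρ) a b := by
  obtain ⟨p, hp⟩ := h
  refine ⟨p, fun t => ⟨hp t, ?_⟩⟩
  by_contra hc
  rw [mem_ball, not_lt] at hc
  have hcont : Continuous (fun t => dist (p t) ζ) := by fun_prop
  have := mem_range_of_exists_le_of_exists_ge hcont ⟨0, by simpa using ha.le⟩ ⟨t, hc⟩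
  obtain ⟨s, hs⟩ := this
  exact hG _ (hp s) hs

lemma RM.near {U : Set ℂ∞} {φ : ℂ → ℂ∞} {ψ : ℂ∞ → ℂ} (h : RM U φ ψ)
    (hol : HolomorphicIntoSphereOn φ (ball (0 : ℂ) 1)) {ζ : ℂ} (hζ : ‖ζ‖ = 1) :
    ∃ (η : ℝ) (g : ℂ → ℂ) (M : ℝ), 0 < η ∧ (∀ z ∈ ball (0 : ℂ) 1 ∩ ball ζ η, φ z = (g z : ℂ∞)) ∧
      DifferentiableOn ℂ g (ball (0 : ℂ) 1 ∩ ball ζ η) ∧ InjOn g (ball (0 : ℂ) 1 ∩ ball ζ η) ∧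
      MapsTo g (ball (0 : ℂ) 1 ∩ ball ζ η) (ball 0 M) := by
  obtain ⟨T, hT, hTU, hTc⟩ := local_compact_nhds (h.op.mem_nhds h.inf)
  have hc : IsCompact (ψ '' T) := hTc.image_of_continuousOn (h.ψc.mono hTU)
  have hζT : ζ ∈ (ψ '' T)ᶜ := by
    rintro ⟨w, hw, rfl⟩
    have := h.ψm (hTU hw)
    rw [mem_ball_zero_iff] at this
    linarith
  obtain ⟨η, hη, hball⟩ := Metric.isOpen_iff.1 hc.isClosed.isOpen_compl ζ hζT
  have hnT : ∀ z ∈ ball (0 : ℂ) 1 ∩ ball ζ η, φ z ∉ T := by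
    rintro z ⟨hz, hz'⟩ hzT
    exact hball hz' ⟨φ z, hzT, h.ψφ z hz⟩
  have hM : ∃ M : ℝ, ∀ w : ℂ, (w : ℂ∞) ∉ T → w ∈ ball (0 : ℂ) M := by
    have h1 : ((↑) : ℂ → ℂ∞) ⁻¹' T ∈ cocompact ℂ := by
      have := tendsto_coe_infty (X := ℂ) hT
      rwa [coclosedCompact_eq_cocompact] at this
    rw [← Metric.cobounded_eq_cocompact] at h1
    have h2 : Bornology.IsBounded (((↑) : ℂ → ℂ∞) ⁻¹' T)ᶜ := Bornology.isBounded_compl_iff.2 h1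
    obtain ⟨M, hM⟩ := h2.subset_ball 0
    exact ⟨M, fun w hw => hM hw⟩
  obtain ⟨M, hM⟩ := hM
  let g : ℂ → ℂ := fun z => (φ z).elim 0 id
  have hg : ∀ z, φ z ≠ ∞ → φ z = (g z : ℂ∞) := by
    intro z hz
    obtain ⟨w, hw⟩ := OnePoint.ne_infty_iff_exists.1 hz
    simp [g, ← hw]
  have hfin : ∀ z ∈ ball (0 : ℂ) 1 ∩ ball ζ η, φ z ≠ ∞ := fun z hz hi =>
    hnT z hz (hi ▸ mem_of_mem_nhds hT)
  have hφg : ∀ z ∈ ball (0 : ℂ) 1 ∩ ball ζ η, φ z = (g z : ℂ∞) := fun z hz => hg z (hfin z hz)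
  refine ⟨η, g, M, hη, hφg, ?_, ?_, ?_⟩
  · intro z hz
    apply DifferentiableAt.differentiableWithinAt
    rcases hol z hz.1 with ⟨k, hk, hk'⟩ | ⟨k, hk, hk'⟩
    · refine hk.differentiableAt.congr_of_eventuallyEq ?_
      filter_upwards [hk'] with w hw
      simp [g, hw]
    · have h0 : k z ≠ 0 := by
        intro h0
        have := hk'.self_of_nhds
        rw [if_pos h0] at this
        exact hfin z hz this
      refine (hk.differentiableAt.inv h0).congr_of_eventuallyEq ?_
      filter_upwards [hk', hk.continuousAt.eventually_ne h0] with w hw hw0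
      simp [g, hw, hw0]
  · intro z hz z' hz' he
    have : φ z = φ z' := by rw [hφg z hz, hφg z' hz', he]
    rw [← h.ψφ z hz.1, this, h.ψφ z' hz'.1]
  · intro z hz
    apply hM
    rw [← hφg z hz]
    exact hnT z hz

lemma RM.forward_step {U : Set ℂ∞} {φ : ℂ → ℂ∞} {ψ : ℂ∞ → ℂ} (h : RM U φ ψ)
    (hol : HolomorphicIntoSphereOn φ (ball (0 : ℂ) 1)) {ζ : ℂ} (hζ : ‖ζ‖ = 1)
    {c : ℂ} {N : Set ℂ∞} {δ r : ℝ} (hδ : 0 < δ) (hδr : δ ≤ r) (hN : IsConnected N) (hNU : N ⊆ Uᶜ)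
    (hNr : N ⊆ (↑) '' closedBall c r) (hNδ : Uᶜ ∩ (↑) '' closedBall c δ ⊆ N)
    {w : ℕ → ℂ∞} (hw : ∀ j, w j ∈ U) (hwt : Tendsto (fun j => ψ (w j)) atTop (𝓝 ζ))
    (hwr : ∀ᶠ j in atTop, w j ∉ ((↑) '' closedBall c r : Set ℂ∞)) {η : ℝ} (hη : 0 < η) :
    ∀ᶠ j in atTop, JoinedIn {z | z ∈ ball (0 : ℂ) 1 ∧ z ∈ ball ζ η ∧
      φ z ∉ ((↑) '' closedBall c (δ / 2) : Set ℂ∞)} (ψ (w j)) (ψ (w (j + 1))) := by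
  obtain ⟨η0, g, M, hη0, hφg, hgd, hgi, hgM⟩ := h.near hol hζ
  have hcl : ∀ d : ℝ, IsClosed ((↑) '' closedBall c d : Set ℂ∞) := fun d =>
    OnePoint.isClosed_image_coe.2 ⟨isClosed_closedBall, isCompact_closedBall c d⟩
  have hev := hwr.and (hwt (ball_mem_nhds ζ hη0))
  obtain ⟨J, hJ⟩ := eventually_atTop.1 hev
  have hψD : ∀ j, ψ (w j) ∈ ball (0 : ℂ) 1 := fun j => h.ψm (hw j)
  have hwg : ∀ j ≥ J, w j = (g (ψ (w j)) : ℂ∞) := fun j hj => by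
    rw [← hφg _ ⟨hψD j, (hJ j hj).2⟩, h.φψ _ (hw j)]
  have hψζ : 0 < dist (ψ (w J)) ζ := by
    rw [dist_pos]
    intro he
    have := hψD J
    rw [he, mem_ball_zero_iff] at this
    linarith
  set η1 := min η (min η0 (dist (ψ (w J)) ζ)) with hη1
  have hη1p : 0 < η1 := by positivity
  have e1 : η1 ≤ η := min_le_left _ _
  have e2 : η1 ≤ η0 := (min_le_right _ _).trans (min_le_left _ _)
  have e3 : η1 ≤ dist (ψ (w J)) ζ := (min_le_right _ _).trans (min_le_right _ _)
  have hsub : ball (0 : ℂ) 1 ∩ ball ζ η1 ⊆ ball (0 : ℂ) 1 ∩ ball ζ η0 :=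
    inter_subset_inter_right _ (ball_subset_ball e2)
  obtain ⟨ρ, hρ0, hρ1, hρ⟩ := length_area g ζ hζ hη1p (hgd.mono hsub) (hgi.mono hsub)
    (hgM.mono_left hsub) (half_pos hδ)
  have hρη0 : ρ < η0 := hρ1.trans_le e2
  have hCg : ∀ z ∈ ball (0 : ℂ) 1, dist z ζ = ρ → φ z = (g z : ℂ∞) := fun z hz hzρ =>
    hφg z ⟨hz, by rw [mem_ball, hzρ]; exact hρη0⟩
  have hNc : closure N ⊆ Uᶜ ∩ (↑) '' closedBall c r :=
    closure_minimal (subset_inter hNU hNr) (h.op.isClosed_compl.inter (hcl r))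
  have hNpre : IsPreconnected (closure N) := hN.isPreconnected.closure
  have hBr : ∀ d ≤ δ, (((↑) '' closedBall c d : Set ℂ∞) ∪ closure N) ⊆ (↑) '' closedBall c r := by
    intro d hd
    refine union_subset (image_mono (closedBall_subset_closedBall (hd.trans hδr))) (hNc.trans inter_subset_right)
  have hxr : ∀ j ≥ J, g (ψ (w j)) ∉ closedBall c r := by
    intro j hj hmem
    exact (hJ j hj).1 ⟨_, hmem, (hwg j hj).symm⟩
  have hr0 : 0 ≤ r := hδ.le.trans hδr
  have hgc : ∀ d ≤ η0, IsPreconnected (g '' (ball (0 : ℂ) 1 ∩ ball ζ d)) := by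
    intro d hd
    refine IsPreconnected.image ?_ _ (hgd.continuousOn.mono (inter_subset_inter_right _ (ball_subset_ball hd)))
    exact ((convex_ball _ _).inter (convex_ball _ _)).isPreconnected
  have key : ∀ (A : Set ℂ∞) (d : ℝ), IsClosed A → Uᶜ ⊆ A → d ≤ δ →
      (A ∩ (((↑) '' closedBall c d : Set ℂ∞) ∪ closure N) = closure N) →
      ∀ i ≥ J, ∀ j ≥ J, HasLog A (fr (g (ψ (w i))) (g (ψ (w j)))) →
      w i ∉ A → w j ∉ A →
      JoinedIn {z | z ∈ ball (0 : ℂ) 1 ∧ φ z ∉ A ∪ (((↑) '' closedBall c d : Set ℂ∞) ∪ closure N)}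
        (ψ (w i)) (ψ (w j)) := by
    intro A d hA hUA hd hAB i hi j hj hlog hiA hjA
    have hB : IsClosed (((↑) '' closedBall c d : Set ℂ∞) ∪ closure N) := (hcl d).union isClosed_closure
    have hlB : HasLog (((↑) '' closedBall c d : Set ℂ∞) ∪ closure N) (fr (g (ψ (w i))) (g (ψ (w j)))) :=
      (hasLog_ball (hxr i hi) (hxr j hj) hr0).mono (hBr d hd)
    have := hlog.glue hA hB hlB (by rw [hAB]; exact hNpre)
    have hnot : ∀ k ≥ J, w k ∉ A → w k ∉ A ∪ (((↑) '' closedBall c d : Set ℂ∞) ∪ closure N) := by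
      rintro k hk hkA (hc | hc)
      · exact hkA hc
      · exact (hJ k hk).1 (hBr d hd hc)
    have hres := h.join (hA.union hB) (hUA.trans subset_union_left) (x := g (ψ (w i))) (y := g (ψ (w j)))
      (by rw [← hwg i hi]; exact hnot i hi hiA) (by rw [← hwg j hj]; exact hnot j hj hjA) this
    rwa [← hwg i hi, ← hwg j hj] at hres
  have hwρ : ∀ᶠ j in atTop, ψ (w j) ∈ ball ζ ρ := hwt (ball_mem_nhds ζ hρ0)
  by_cases hcase : ∃ z ∈ ball (0 : ℂ) 1, dist z ζ = ρ ∧ g z ∈ closedBall c (δ / 2)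
  · exfalso
    obtain ⟨z, hz, hzρ, hzc⟩ := hcase
    obtain ⟨j, hjρ, hjJ⟩ := (hwρ.and (eventually_ge_atTop J)).exists
    have hjoin := key Uᶜ δ h.op.isClosed_compl subset_rfl le_rfl (by
      apply Subset.antisymm
      · rintro p ⟨hp1, hp2 | hp2⟩
        · exact subset_closure (hNδ ⟨hp1, hp2⟩)
        · exact hp2
      · intro p hp
        exact ⟨(hNc hp).1, Or.inr hp⟩) j hjJ J le_rfl (by
        refine hasLog_of_conn h.op.isClosed_compl (hgc η0 le_rfl) ?_ ⟨_, ⟨hψD j, (hJ j hjJ).2⟩, rfl⟩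
          ⟨_, ⟨hψD J, (hJ J le_rfl).2⟩, rfl⟩
        rintro _ ⟨u, hu, rfl⟩
        rw [← hφg u hu, notMem_compl_iff]
        exact h.φm hu.1) (notMem_compl_iff.2 (hw j)) (notMem_compl_iff.2 (hw J))
    have hj2 := joined_ball (ζ := ζ) (ρ := ρ) hjoin (by
      rintro u ⟨hu, huX⟩ huρ
      apply huX
      right; left
      refine ⟨g u, ?_, (hCg u hu huρ).symm⟩
      have := hρ u hu z hz huρ hzρ
      rw [mem_closedBall] at hzc ⊢
      linarith [dist_triangle (g u) (g z) c]) hjρ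
    have := hj2.target_mem.2
    rw [mem_ball] at this
    linarith
  · push Not at hcase
    have hAo : IsOpen (U ∩ ψ ⁻¹' {z | dist z ζ = ρ}ᶜ) := by
      refine h.ψc.isOpen_inter_preimage h.op ?_
      exact (isClosed_eq (by fun_prop) continuous_const).isOpen_compl
    filter_upwards [hwρ, (tendsto_add_atTop_nat 1).eventually hwρ, eventually_ge_atTop J] with j hj1 hj2 hjJ
    have hjJ' : j + 1 ≥ J := by omega
    have hnA : ∀ k, ψ (w k) ∈ ball ζ ρ → w k ∉ (U ∩ ψ ⁻¹' {z | dist z ζ = ρ}ᶜ)ᶜ := by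
      intro k hk
      rw [notMem_compl_iff]
      refine ⟨hw k, ?_⟩
      intro he
      rw [mem_ball] at hk
      exact hk.ne he
    have hjoin := key (U ∩ ψ ⁻¹' {z | dist z ζ = ρ}ᶜ)ᶜ (δ / 2) hAo.isClosed_compl
      (compl_subset_compl.2 inter_subset_left) (by linarith) (by
      apply Subset.antisymm
      · rintro p ⟨hp1, hp2 | hp2⟩
        · by_cases hpU : p ∈ U
          · exfalso
            have hpρ : dist (ψ p) ζ = ρ := by
              by_contra hne
              exact hp1 ⟨hpU, hne⟩
            have h1 := hCg _ (h.ψm hpU) hpρ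
            rw [h.φψ p hpU] at h1
            obtain ⟨q, hq, hqp⟩ := hp2
            rw [← hqp, OnePoint.coe_eq_coe, hqp] at h1
            exact hcase _ (h.ψm hpU) hpρ (h1 ▸ hq)
          · refine subset_closure (hNδ ⟨hpU, ?_⟩)
            exact image_mono (closedBall_subset_closedBall (by linarith)) hp2
        · exact hp2
      · intro p hp
        exact ⟨fun hc => (hNc hp).1 hc.1, Or.inr hp⟩) j hjJ (j + 1) hjJ' (by
        refine hasLog_of_conn hAo.isClosed_compl (hgc ρ hρη0.le) ?_ ⟨_, ⟨hψD j, hj1⟩, rfl⟩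
          ⟨_, ⟨hψD (j + 1), hj2⟩, rfl⟩
        rintro _ ⟨u, hu, rfl⟩
        rw [← hφg u ⟨hu.1, ball_subset_ball hρη0.le hu.2⟩, notMem_compl_iff]
        refine ⟨h.φm hu.1, ?_⟩
        intro he
        have he : dist (ψ (φ u)) ζ = ρ := he
        rw [h.ψφ u hu.1] at he
        have := hu.2
        rw [mem_ball] at this
        linarith) (hnA j hj1) (hnA (j + 1) hj2)
    have hj2 := joined_ball (ζ := ζ) (ρ := ρ) hjoin (by
      rintro u ⟨hu, huX⟩ huρ
      apply huX
      left
      intro hc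
      have : ¬ dist (ψ (φ u)) ζ = ρ := hc.2
      rw [h.ψφ u hu] at this
      exact this huρ) hj1
    refine hj2.mono ?_
    rintro u ⟨⟨hu, huX⟩, huρ⟩
    exact ⟨hu, ball_subset_ball (hρ1.le.trans e1) huρ, fun hc => huX (Or.inr (Or.inl hc))⟩

lemma cball_closed (c : ℂ) (d : ℝ) : IsClosed ((↑) '' closedBall c d : Set ℂ∞) :=
  OnePoint.isClosed_image_coe.2 ⟨isClosed_closedBall, isCompact_closedBall c d⟩

lemma cball_nhds (c : ℂ) {d : ℝ} (hd : 0 < d) : ((↑) '' closedBall c d : Set ℂ∞) ∈ 𝓝 (c : ℂ∞) := by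
  rw [OnePoint.nhds_coe_eq]
  exact image_mem_map (closedBall_mem_nhds c hd)

lemma nhds_cball {c : ℂ} {T : Set ℂ∞} (hT : T ∈ 𝓝 (c : ℂ∞)) :
    ∃ d : ℝ, 0 < d ∧ ((↑) '' closedBall c d : Set ℂ∞) ⊆ T := by
  rw [OnePoint.nhds_coe_eq, mem_map] at hT
  obtain ⟨d, hd, h⟩ := Metric.nhds_basis_closedBall.mem_iff.1 hT
  exact ⟨d, hd, image_subset_iff.2 h⟩

lemma not_seqAccum {w : ℕ → ℂ∞} {c : ℂ} (h : ¬ SeqAccumAt w c) :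
    ∃ r : ℝ, 0 < r ∧ ∀ᶠ j in atTop, w j ∉ ((↑) '' closedBall c r : Set ℂ∞) := by
  by_contra hc
  push Not at hc
  apply h
  obtain ⟨n, hn, hn'⟩ := extraction_forall_of_frequently
    (P := fun (k : ℕ) j => w j ∈ ((↑) '' closedBall c (1 / ((k : ℝ) + 1)) : Set ℂ∞))
    (fun k => by
      have := hc (1 / ((k : ℝ) + 1)) (by positivity)
      simpa [Filter.Frequently] using this)
  refine ⟨n, hn, ?_⟩
  intro T hT
  obtain ⟨d, hd, hdT⟩ := nhds_cball hT
  have h1 : ∀ᶠ k : ℕ in atTop, 1 / ((k : ℝ) + 1) < d :=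
    tendsto_one_div_add_atTop_nhds_zero_nat.eventually (gt_mem_nhds hd)
  rw [mem_map]
  filter_upwards [h1] with k hk
  exact hdT (image_mono (closedBall_subset_closedBall hk.le) (hn' k))

def chain {a : ℕ → ℂ} (p : ∀ j, Path (a j) (a (j + 1))) (t : ℝ) : ℂ :=
  (p ⌊t⌋₊).extend (t - ⌊t⌋₊)

lemma chain_nat {a : ℕ → ℂ} (p : ∀ j, Path (a j) (a (j + 1))) (n : ℕ) : chain p n = a n := by
  unfold chain
  rw [Nat.floor_natCast]
  simp

lemma chain_mem {a : ℕ → ℂ} (p : ∀ j, Path (a j) (a (j + 1))) (t : ℝ) :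
    chain p t ∈ range (p ⌊t⌋₊) := by
  unfold chain
  rw [← Path.extend_range]
  exact mem_range_self _

lemma chain_eq {a : ℕ → ℂ} (p : ∀ j, Path (a j) (a (j + 1))) (n : ℕ) {t : ℝ}
    (ht : t ∈ Icc (n : ℝ) (n + 1)) : chain p t = (p n).extend (t - n) := by
  rcases ht.2.lt_or_eq with h | h
  · have : ⌊t⌋₊ = n := (Nat.floor_eq_iff (le_trans (Nat.cast_nonneg n) ht.1)).2 ⟨ht.1, h⟩
    unfold chain
    rw [this]
  · have h2 : t = ((n + 1 : ℕ) : ℝ) := by rw [h]; push_cast; rfl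
    have h3 : t - n = 1 := by rw [h]; ring
    rw [h3, Path.extend_one, h2, chain_nat]

lemma chain_cont {a : ℕ → ℂ} (p : ∀ j, Path (a j) (a (j + 1))) : ContinuousOn (chain p) (Ici 0) := by
  have hlf : LocallyFinite (fun n : ℕ => Icc (n : ℝ) (n + 1)) := by
    intro x
    refine ⟨ball x 1, ball_mem_nhds x one_pos, ?_⟩
    refine (Set.finite_Iic ⌈x + 1⌉₊).subset ?_
    rintro n ⟨y, hy1, hy2⟩
    rw [mem_ball, Real.dist_eq, abs_lt] at hy2
    have : (n : ℝ) ≤ ⌈x + 1⌉₊ := by linarith [Nat.le_ceil (x + 1), hy1.1]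
    exact_mod_cast this
  have := hlf.continuousOn_iUnion (fun n => isClosed_Icc) (g := chain p) (fun n => by
    refine ContinuousOn.congr (f := fun t => (p n).extend (t - n)) ?_ (fun t ht => chain_eq p n ht)
    exact ((p n).continuous_extend.comp (by fun_prop)).continuousOn)
  refine this.mono ?_
  intro t ht
  rw [mem_iUnion]
  exact ⟨⌊t⌋₊, Nat.floor_le ht, (Nat.lt_floor_add_one t).le⟩

lemma RM.forward {U : Set ℂ∞} {φ : ℂ → ℂ∞} {ψ : ℂ∞ → ℂ} (h : RM U φ ψ)
    (hol : HolomorphicIntoSphereOn φ (ball (0 : ℂ) 1)) {c : ℂ}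
    (hlc : LocallyConnectedAt Uᶜ (c : ℂ∞)) {ζ : ℂ} (hζ : ‖ζ‖ = 1) : StronglyMinimal U ψ ζ c := by
  intro w hw hwt hacc
  obtain ⟨r, hr, hwr⟩ := not_seqAccum hacc
  obtain ⟨N, hNn, hNV, hNc⟩ := hlc _ (mem_nhdsWithin_of_mem_nhds (cball_nhds c hr))
  obtain ⟨T, hT, hTN⟩ := mem_nhdsWithin_iff_exists_mem_nhds_inter.1 hNn
  obtain ⟨d, hd, hdT⟩ := nhds_cball hT
  set δ := min d r with hδ
  have hδp : 0 < δ := lt_min hd hr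
  have hNδ : Uᶜ ∩ (↑) '' closedBall c δ ⊆ N := by
    rintro z ⟨hz1, hz2⟩
    exact hTN ⟨hdT (image_mono (closedBall_subset_closedBall (min_le_left _ _)) hz2), hz1⟩
  have step := fun (η : ℝ) (hη : 0 < η) => h.forward_step hol hζ hδp (min_le_right _ _) hNc
    (hNV.trans inter_subset_left) (hNV.trans inter_subset_right) hNδ hw hwt hwr hη
  let G : ℕ → Set ℂ := fun n => {z | z ∈ ball (0 : ℂ) 1 ∧ (n ≠ 0 → z ∈ ball ζ (1 / (n : ℝ)) ∧
      φ z ∉ ((↑) '' closedBall c (δ / 2) : Set ℂ∞))}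
  let P : ℕ → ℕ → Prop := fun j n => JoinedIn (G n) (ψ (w j)) (ψ (w (j + 1)))
  classical
  let m : ℕ → ℕ := fun j => Nat.findGreatest (P j) j
  have hP0 : ∀ j, P j 0 := by
    intro j
    have : JoinedIn (ball (0 : ℂ) 1) (ψ (w j)) (ψ (w (j + 1))) :=
      JoinedIn.of_segment_subset ((convex_ball (0 : ℂ) 1).segment_subset (h.ψm (hw j)) (h.ψm (hw _)))
    exact this.mono (fun z hz => ⟨hz, fun h0 => absurd rfl h0⟩)
  have hm : ∀ j, P j (m j) := fun j => Nat.findGreatest_spec (Nat.zero_le j) (hP0 j)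
  have hmt : ∀ n, ∀ᶠ j in atTop, n ≤ m j := by
    intro n
    rcases Nat.eq_zero_or_pos n with rfl | hn
    · exact Eventually.of_forall fun j => Nat.zero_le _
    · filter_upwards [step (1 / (n : ℝ)) (by positivity), eventually_ge_atTop n] with j hj hjn
      exact Nat.le_findGreatest hjn (hj.mono fun z hz => ⟨hz.1, fun _ => hz.2⟩)
  choose p hp using hm
  have hch : ∀ t, chain p t ∈ G (m ⌊t⌋₊) := by
    intro t
    obtain ⟨s, hs⟩ := chain_mem p t
    rw [← hs]
    exact hp _ s
  have hchb : ∀ t, chain p t ∈ ball (0 : ℂ) 1 := fun t => (hch t).1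
  refine ⟨fun t => φ (chain p t), ⟨⟨?_, ?_⟩, ?_⟩, ?_, ?_⟩
  · exact h.φc.comp (chain_cont p) (fun t _ => hchb t)
  · exact fun t _ => h.φm (hchb t)
  · have : (fun t => ψ (φ (chain p t))) = chain p := funext fun t => h.ψφ _ (hchb t)
    rw [this, Metric.tendsto_nhds]
    intro ε hε
    obtain ⟨n, hn⟩ := exists_nat_one_div_lt hε
    have := tendsto_nat_floor_atTop (α := ℝ) |>.eventually (hmt (n + 1))
    filter_upwards [this] with t ht
    have h1 := ((hch t).2 (by omega)).1
    rw [mem_ball] at h1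
    refine h1.trans (lt_of_le_of_lt ?_ hn)
    apply one_div_le_one_div_of_le (by positivity)
    exact_mod_cast ht
  · intro j
    refine ⟨j, Nat.cast_nonneg j, ?_⟩
    simp only [chain_nat]
    exact h.φψ _ (hw j)
  · rintro ⟨t, ht, ht'⟩
    have h1 := ht' (cball_nhds c (half_pos hδp))
    have h2 := ht.eventually (tendsto_nat_floor_atTop (α := ℝ) |>.eventually (hmt 1))
    obtain ⟨j, hj1, hj2⟩ := (h2.and h1).exists
    exact ((hch (t j)).2 (by omega)).2 hj2

lemma off_cball {c b : ℂ} {ρ : ℝ} (hb : 2 * ‖b - c‖ ≤ ρ) {z : ℂ∞}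
    (hz : z ∉ ((↑) '' closedBall c ρ : Set ℂ∞)) : ∀ u : ℂ, z = u → ‖b - c‖ < ‖u - b‖ := by
  rintro u rfl
  have h1 : ρ < ‖u - c‖ := by
    by_contra hc
    exact hz ⟨u, by rw [mem_closedBall, dist_eq_norm]; exact not_lt.1 hc, rfl⟩
  have h2 : ‖u - c‖ ≤ ‖u - b‖ + ‖b - c‖ := norm_sub_le_norm_sub_add_norm_sub u b c
  linarith

lemma RM.claim {U : Set ℂ∞} {φ : ℂ → ℂ∞} {ψ : ℂ∞ → ℂ} (h : RM U φ ψ) {c b : ℂ}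
    (hc : (c : ℂ∞) ∉ U) (hb : (b : ℂ∞) ∉ U) {ε ρ : ℝ} (hρ : 2 * ‖b - c‖ ≤ ρ) (hρε : ρ ≤ ε)
    (hno : ¬ HasLog (Uᶜ ∩ (↑) '' closedBall c ε)ᶜ (fr c b))
    (h0 : φ 0 ∉ ((↑) '' closedBall c ρ : Set ℂ∞)) :
    ∃ q ∈ ball (0 : ℂ) 1, φ q ∉ ((↑) '' closedBall c ε : Set ℂ∞) ∧
      ∀ S : Set ℂ, IsPreconnected S → S ⊆ ball (0 : ℂ) 1 → 0 ∈ S → q ∈ S →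
        ∃ s ∈ S, φ s ∈ ((↑) '' closedBall c ρ : Set ℂ∞) := by
  by_contra hcon
  push Not at hcon
  have hne : ∀ z ∈ U, z ≠ (c : ℂ∞) ∧ z ≠ (b : ℂ∞) := fun z hz =>
    ⟨fun e => hc (e ▸ hz), fun e => hb (e ▸ hz)⟩
  obtain ⟨l, hl, hl'⟩ := log_ball (fun z => fr c b (φ z))
    (fun z hz => (fr_continuousAt (hne _ (h.φm hz)).2).comp_continuousWithinAt (h.φc z hz))
    (fun z hz => fr_ne_zero (hne _ (h.φm hz)).1 (hne _ (h.φm hz)).2)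
  have hDm : (0 : ℂ) ∈ ball (0 : ℂ) 1 := mem_ball_self one_pos
  set k := l 0 - Complex.log (fr c b (φ 0)) with hk
  have hfz : ∀ z : ℂ∞, z ∉ ((↑) '' closedBall c ρ : Set ℂ∞) →
      Complex.exp (Complex.log (fr c b z)) = fr c b z := fun z hz =>
    Complex.exp_log (Complex.slitPlane_ne_zero (fr_slit (off_cball hρ hz)))
  have hek : Complex.exp k = 1 := by
    rw [hk, Complex.exp_sub, hl' 0 hDm, hfz _ h0]
    exact div_self (fr_ne_zero (hne _ (h.φm hDm)).1 (hne _ (h.φm hDm)).2)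
  have hsubB : ((↑) '' closedBall c ρ : Set ℂ∞) ⊆ (↑) '' closedBall c ε :=
    image_mono (closedBall_subset_closedBall hρε)
  have hD : ∀ q ∈ ball (0 : ℂ) 1, φ q ∉ ((↑) '' closedBall c ε : Set ℂ∞) →
      l q - Complex.log (fr c b (φ q)) = k := by
    intro q hq hqε
    obtain ⟨S, hS, hSb, hS0, hSq, hSρ⟩ := hcon q hq hqε
    refine log_diff_const (m := fun q => Complex.log (fr c b (φ q))) hS (hl.mono hSb) ?_ ?_ hSq hS0
    · intro s hs
      exact (fr_slit_cont (off_cball hρ (hSρ s hs))).comp_continuousWithinAt ((h.φc.mono hSb) s hs)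
    · intro s hs
      rw [hl' s (hSb hs), hfz _ (hSρ s hs)]
  classical
  apply hno
  have hL : ∀ z : ℂ∞, z ∉ ((↑) '' closedBall c ε : Set ℂ∞) →
      (if z ∈ U then l (ψ z) - k else Complex.log (fr c b z)) = Complex.log (fr c b z) := by
    intro z hz
    split_ifs with hzU
    · have := hD (ψ z) (h.ψm hzU) (by rw [h.φψ z hzU]; exact hz)
      rw [h.φψ z hzU] at this
      rw [← this]; ring
    · rfl
  refine ⟨fun z => if z ∈ U then l (ψ z) - k else Complex.log (fr c b z), ?_, ?_⟩
  · intro z hz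
    apply ContinuousAt.continuousWithinAt
    by_cases hzU : z ∈ U
    · have h1 : ContinuousAt (fun z => l (ψ z) - k) z := by
        have h2 : ContinuousAt ψ z := h.ψc.continuousAt (h.op.mem_nhds hzU)
        have h3 : ContinuousAt l (ψ z) := hl.continuousAt (isOpen_ball.mem_nhds (h.ψm hzU))
        exact (ContinuousAt.comp h3 h2).sub continuousAt_const
      refine h1.congr ?_
      filter_upwards [h.op.mem_nhds hzU] with y hy
      rw [if_pos hy]
    · have hzε : z ∉ ((↑) '' closedBall c ε : Set ℂ∞) := fun hh => hz ⟨hzU, hh⟩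
      refine (fr_slit_cont (off_cball hρ (fun hh => hzε (hsubB hh)))).congr ?_
      filter_upwards [(cball_closed c ε).isOpen_compl.mem_nhds hzε] with y hy
      exact (hL y hy).symm
  · intro z hz
    by_cases hzU : z ∈ U
    · simp only [if_pos hzU]
      rw [Complex.exp_sub, hek, div_one, hl' _ (h.ψm hzU), h.φψ z hzU]
    · have hzε : z ∉ ((↑) '' closedBall c ε : Set ℂ∞) := fun hh => hz ⟨hzU, hh⟩
      simp only [hL z hzε]
      exact hfz z (fun hh => hzε (hsubB hh))

lemma tail_avoid {Γ : ℝ → ℂ∞} {c : ℂ} (h : (c : ℂ∞) ∉ accSet Γ) :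
    ∃ δ : ℝ, 0 < δ ∧ ∃ T : ℝ, ∀ t ≥ T, Γ t ∉ ((↑) '' closedBall c δ : Set ℂ∞) := by
  by_contra hc
  push Not at hc
  apply h
  choose t ht ht' using fun n : ℕ => hc (1 / ((n : ℝ) + 1)) (by positivity) n
  refine ⟨t, tendsto_atTop_mono ht tendsto_natCast_atTop_atTop, ?_⟩
  intro T hT
  obtain ⟨d, hd, hdT⟩ := nhds_cball hT
  have h1 : ∀ᶠ k : ℕ in atTop, 1 / ((k : ℝ) + 1) < d :=
    tendsto_one_div_add_atTop_nhds_zero_nat.eventually (gt_mem_nhds hd)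
  rw [mem_map]
  filter_upwards [h1] with k hk
  exact hdT (image_mono (closedBall_subset_closedBall hk.le) (ht' k))

lemma compact_avoid {U : Set ℂ∞} {c : ℂ} (hc : (c : ℂ∞) ∉ U) {A : Set ℂ∞} (hA : IsCompact A)
    (hAU : A ⊆ U) : ∃ δ : ℝ, 0 < δ ∧ ∀ z ∈ A, z ∉ ((↑) '' closedBall c δ : Set ℂ∞) := by
  have : Aᶜ ∈ 𝓝 (c : ℂ∞) := hA.isClosed.isOpen_compl.mem_nhds (fun hh => hc (hAU hh))
  obtain ⟨d, hd, hdT⟩ := nhds_cball this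
  exact ⟨d, hd, fun z hz hz' => hdT hz' hz⟩

lemma RM.claimC {U : Set ℂ∞} {φ : ℂ → ℂ∞} {ψ : ℂ∞ → ℂ} (h : RM U φ ψ) {c : ℂ}
    (hc : (c : ℂ∞) ∉ U)
    (hsm : ∀ ζ ∈ sphere (0 : ℂ) 1, (c : ℂ∞) ∈ impression φ ζ → StronglyMinimal U ψ ζ c)
    {ε : ℝ} (hε : 0 < ε) :
    ∃ d : ℝ, 0 < d ∧ ∀ b : ℂ, (b : ℂ∞) ∉ U → ‖b - c‖ < d →
      HasLog (Uᶜ ∩ (↑) '' closedBall c ε)ᶜ (fr c b) := by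
  by_contra hcon
  push Not at hcon
  have hDm : (0 : ℂ) ∈ ball (0 : ℂ) 1 := mem_ball_self one_pos
  obtain ⟨ρ0, hρ0, h0⟩ := compact_avoid hc (isCompact_singleton (x := φ 0))
    (singleton_subset_iff.2 (h.φm hDm))
  replace h0 := h0 _ rfl
  set ρ1 := min ρ0 ε with hρ1
  have hρ1p : 0 < ρ1 := lt_min hρ0 hε
  let ρ : ℕ → ℝ := fun n => ρ1 * (1 / ((n : ℝ) + 1))
  have hρp : ∀ n, 0 < ρ n := fun n => by positivity
  have hρle : ∀ n, ρ n ≤ ρ1 := fun n => by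
    have : 1 / ((n : ℝ) + 1) ≤ 1 := by
      rw [div_le_one (by positivity)]
      linarith [Nat.cast_nonneg (α := ℝ) n]
    exact mul_le_of_le_one_right hρ1p.le this
  have hρt : Tendsto ρ atTop (𝓝 0) := by
    have := (tendsto_one_div_add_atTop_nhds_zero_nat (𝕜 := ℝ)).const_mul ρ1
    rwa [mul_zero] at this
  choose b hbU hbd hbl using fun n => hcon (ρ n / 2) (half_pos (hρp n))
  choose q hq hqε hqS using fun n => h.claim hc (hbU n) (ρ := ρ n) (by linarith [hbd n])
    ((hρle n).trans (min_le_right _ _)) (hbl n)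
    (fun hh => h0 (image_mono (closedBall_subset_closedBall ((hρle n).trans (min_le_left _ _))) hh))
  have hseg : ∀ n, ∃ τ ∈ Icc (0 : ℝ) 1, φ (τ • q n) ∈ ((↑) '' closedBall c (ρ n) : Set ℂ∞) := by
    intro n
    obtain ⟨s, hs, hs'⟩ := hqS n (segment ℝ 0 (q n)) (convex_segment _ _).isPreconnected
      ((convex_ball (0 : ℂ) 1).segment_subset hDm (hq n)) (left_mem_segment _ _ _)
      (right_mem_segment _ _ _)
    rw [segment_eq_image] at hs
    obtain ⟨τ, hτ, rfl⟩ := hs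
    refine ⟨τ, hτ, ?_⟩
    simpa using hs'
  choose τ hτ hτc using hseg
  have hsb : ∀ n, τ n • q n ∈ ball (0 : ℂ) 1 := by
    intro n
    have h1 := hq n
    rw [mem_ball_zero_iff] at h1 ⊢
    rw [norm_smul, Real.norm_eq_abs, abs_of_nonneg (hτ n).1]
    nlinarith [(hτ n).2, (hτ n).1, norm_nonneg (q n)]
  obtain ⟨⟨ζ, σ⟩, hζσ, n, hn, hlim⟩ := ((isCompact_closedBall (0 : ℂ) 1).prod
    (isCompact_Icc (a := (0 : ℝ)) (b := 1))).tendsto_subseq (x := fun n => (q n, τ n))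
    (fun n => ⟨ball_subset_closedBall (hq n), hτ n⟩)
  have hql : Tendsto (fun k => q (n k)) atTop (𝓝 ζ) := (continuous_fst.tendsto _).comp hlim
  have hτl : Tendsto (fun k => τ (n k)) atTop (𝓝 σ) := (continuous_snd.tendsto _).comp hlim
  have hsl : Tendsto (fun k => τ (n k) • q (n k)) atTop (𝓝 (σ • ζ)) := hτl.smul hql
  have hρn : Tendsto (fun k => ρ (n k)) atTop (𝓝 0) := hρt.comp hn.tendsto_atTop
  have hφs : Tendsto (fun k => φ (τ (n k) • q (n k))) atTop (𝓝 (c : ℂ∞)) := by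
    intro T hT
    obtain ⟨d, hd, hdT⟩ := nhds_cball hT
    rw [mem_map]
    filter_upwards [hρn.eventually (gt_mem_nhds hd)] with k hk
    exact hdT (image_mono (closedBall_subset_closedBall hk.le) (hτc (n k)))
  have hnb : σ • ζ ∉ ball (0 : ℂ) 1 := by
    intro hb
    have h1 : ContinuousAt φ (σ • ζ) := h.φc.continuousAt (isOpen_ball.mem_nhds hb)
    have h2 := tendsto_nhds_unique (h1.tendsto.comp hsl) hφs
    exact hc (h2 ▸ h.φm hb)
  have hζ1 : ‖ζ‖ ≤ 1 := mem_closedBall_zero_iff.1 hζσ.1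
  have hσ : σ ∈ Icc (0 : ℝ) 1 := hζσ.2
  rw [mem_ball_zero_iff, norm_smul, Real.norm_eq_abs, abs_of_nonneg hσ.1, not_lt] at hnb
  have hζ2 : ‖ζ‖ = 1 := by nlinarith [hσ.1, hσ.2, norm_nonneg ζ]
  have hσ2 : σ = 1 := by rw [hζ2, mul_one] at hnb; exact le_antisymm hσ.2 hnb
  rw [hσ2, one_smul] at hsl
  obtain ⟨Γ, ⟨⟨hΓc, hΓm⟩, -⟩, hΓw, hΓa⟩ := hsm ζ (by rw [mem_sphere_zero_iff_norm]; exact hζ2)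
    ⟨_, fun k => hsb (n k), hsl, hφs⟩ (fun k => φ (q (n k))) (fun k => h.φm (hq _))
    (by simpa only [h.ψφ _ (hq _)] using hql)
    (by
      rintro ⟨m, -, hm⟩
      obtain ⟨j, hj⟩ := (hm.eventually (cball_nhds c hε)).exists
      exact hqε _ hj)
  obtain ⟨δ1, hδ1, T, hT⟩ := tail_avoid hΓa
  obtain ⟨δ2, hδ2, hT2⟩ := compact_avoid hc
    ((isCompact_Icc (a := (0 : ℝ)) (b := T)).image_of_continuousOn (hΓc.mono Icc_subset_Ici_self))
    (by
      rintro _ ⟨t, ht, rfl⟩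
      exact hΓm ht.1)
  have hsegb : segment ℝ 0 (q (n 0)) ⊆ ball (0 : ℂ) 1 :=
    (convex_ball (0 : ℂ) 1).segment_subset hDm (hq _)
  have hsegc : IsCompact (segment ℝ (0 : ℂ) (q (n 0))) := by
    rw [segment_eq_image]
    exact isCompact_Icc.image (by fun_prop)
  obtain ⟨δ3, hδ3, hT3⟩ := compact_avoid hc (hsegc.image_of_continuousOn (h.φc.mono hsegb))
    (by
      rintro _ ⟨t, ht, rfl⟩
      exact h.φm (hsegb ht))
  set δ := min δ1 (min δ2 δ3) with hδ
  have hδp : 0 < δ := lt_min hδ1 (lt_min hδ2 hδ3)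
  obtain ⟨k, hk⟩ := (hρn.eventually (gt_mem_nhds hδp)).exists
  have hψΓ : ContinuousOn (fun t => ψ (Γ t)) (Ici 0) := h.ψc.comp hΓc hΓm
  have hmemq : ∀ k, q (n k) ∈ (fun t => ψ (Γ t)) '' Ici 0 := by
    intro k
    obtain ⟨t, ht, hte⟩ := hΓw k
    refine ⟨t, ht, ?_⟩
    simp only [hte]
    exact h.ψφ _ (hq _)
  have hS : IsPreconnected ((fun t => ψ (Γ t)) '' Ici 0 ∪ segment ℝ 0 (q (n 0))) :=
    IsPreconnected.union (q (n 0)) (hmemq 0) (right_mem_segment _ _ _)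
      ((isPreconnected_Ici).image _ hψΓ) (convex_segment _ _).isPreconnected
  obtain ⟨s, hs, hsc⟩ := hqS (n k) _ hS (union_subset (by
    rintro _ ⟨t, ht, rfl⟩
    exact h.ψm (hΓm ht)) hsegb) (Or.inr (left_mem_segment _ _ _)) (Or.inl (hmemq k))
  have hsd : ∀ d, δ ≤ d → φ s ∈ ((↑) '' closedBall c d : Set ℂ∞) := fun d hd =>
    image_mono (closedBall_subset_closedBall (hk.le.trans hd)) hsc
  rcases hs with ⟨t, ht, rfl⟩ | hs
  · simp only [h.φψ _ (hΓm ht)] at hsd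
    by_cases htT : T ≤ t
    · exact hT t htT (hsd _ (min_le_left _ _))
    · exact hT2 _ ⟨t, ⟨ht, (not_le.1 htT).le⟩, rfl⟩
        (hsd _ ((min_le_right _ _).trans (min_le_left _ _)))
  · exact hT3 _ ⟨s, hs, rfl⟩ (hsd _ ((min_le_right _ _).trans (min_le_right _ _)))

lemma RM.backward {U : Set ℂ∞} {φ : ℂ → ℂ∞} {ψ : ℂ∞ → ℂ} (h : RM U φ ψ) {c : ℂ}
    (hc : (c : ℂ∞) ∉ U)
    (hsm : ∀ ζ ∈ sphere (0 : ℂ) 1, (c : ℂ∞) ∈ impression φ ζ → StronglyMinimal U ψ ζ c) :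
    LocallyConnectedAt Uᶜ (c : ℂ∞) := by
  intro V hV
  obtain ⟨T, hT, hTV⟩ := mem_nhdsWithin_iff_exists_mem_nhds_inter.1 hV
  obtain ⟨ε, hε, hεT⟩ := nhds_cball hT
  obtain ⟨d, hd, hlog⟩ := h.claimC hc hsm hε
  set Kε : Set ℂ∞ := Uᶜ ∩ (↑) '' closedBall c ε with hK
  have hKc : IsClosed Kε := h.op.isClosed_compl.inter (cball_closed c ε)
  haveI : CompactSpace Kε := isCompact_iff_compactSpace.1 hKc.isCompact
  have hcK : (c : ℂ∞) ∈ Kε := ⟨hc, c, mem_closedBall_self hε.le, rfl⟩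
  refine ⟨Subtype.val '' connectedComponent (⟨c, hcK⟩ : Kε), ?_, ?_,
    isConnected_connectedComponent.image _ continuous_subtype_val.continuousOn⟩
  · rw [mem_nhdsWithin_iff_exists_mem_nhds_inter]
    refine ⟨(↑) '' closedBall c (min (d / 2) ε), cball_nhds c (by positivity), ?_⟩
    rintro _ ⟨⟨b, hb, rfl⟩, hbU⟩
    rw [mem_closedBall, dist_eq_norm] at hb
    have hbK : (b : ℂ∞) ∈ Kε := ⟨hbU, b, by
      rw [mem_closedBall, dist_eq_norm]; exact hb.trans (min_le_right _ _), rfl⟩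
    refine ⟨⟨b, hbK⟩, ?_, rfl⟩
    by_contra hbn
    rw [connectedComponent_eq_iInter_isClopen, mem_iInter] at hbn
    push Not at hbn
    obtain ⟨⟨Z, hZ, hcZ⟩, hbZ⟩ := hbn
    have hP : IsCompact ((↑) '' Z : Set ℂ∞) := hZ.isClosed.isCompact.image continuous_subtype_val
    have hQ : IsCompact ((↑) '' Zᶜ : Set ℂ∞) :=
      hZ.compl.isClosed.isCompact.image continuous_subtype_val
    have hPQ : Disjoint ((↑) '' Z : Set ℂ∞) ((↑) '' Zᶜ) :=
      (disjoint_image_iff Subtype.val_injective).2 disjoint_compl_right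
    obtain ⟨V1, W1, hV1, hW1, hPV, hQW, hVW⟩ := SeparatedNhds.of_isCompact_isCompact hP hQ hPQ
    have hcl : closure V1 ⊆ W1ᶜ :=
      closure_minimal hVW.subset_compl_right hW1.isClosed_compl
    refine lemmaS c b V1 hV1 (hPV ⟨_, hcZ, rfl⟩) (fun hh => hcl hh (hQW ⟨_, hbZ, rfl⟩)) ?_
    refine (hlog b hbU (by linarith [hb.trans (min_le_left _ _)])).mono ?_
    intro z hz hzK
    by_cases hzZ : (⟨z, hzK⟩ : Kε) ∈ Z
    · rw [hV1.frontier_eq] at hz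
      exact hz.2 (hPV ⟨_, hzZ, rfl⟩)
    · exact hcl (frontier_subset_closure hz) (hQW ⟨_, hzZ, rfl⟩)
  · rintro _ ⟨z, -, rfl⟩
    exact ⟨z.2.1, hTV ⟨hεT z.2.2, z.2.1⟩⟩

/-- `K` is locally connected at `z₀ ∈ ∂U` iff `z₀` is strongly minimal in every prime end
whose impression contains `z₀`. -/
theorem stmt2
    (U : Set ℂ∞) (hUopen : IsOpen U) (hUconn : IsConnected U)
    (hUsc : SimplyConnectedSpace U) (hinfty : ∞ ∈ U)
    (hKconn : IsConnected Uᶜ) (hKnt : Set.Nontrivial Uᶜ)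
    (φ : ℂ → ℂ∞) (ψ : ℂ∞ → ℂ)
    (hφcont : ContinuousOn φ (ball (0 : ℂ) 1))
    (hφmaps : MapsTo φ (ball (0 : ℂ) 1) U)
    (hφhol : HolomorphicIntoSphereOn φ (ball (0 : ℂ) 1))
    (hψcont : ContinuousOn ψ U)
    (hψmaps : MapsTo ψ U (ball (0 : ℂ) 1))
    (hψφ : ∀ z ∈ ball (0 : ℂ) 1, ψ (φ z) = z)
    (hφψ : ∀ w ∈ U, φ (ψ w) = w)
    (z₀ : ℂ∞) (hz₀ : z₀ ∈ frontier U) :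
    LocallyConnectedAt Uᶜ z₀ ↔
      ∀ ζ ∈ sphere (0 : ℂ) 1, z₀ ∈ impression φ ζ → StronglyMinimal U ψ ζ z₀ := by
  have h : RM U φ ψ := ⟨hUopen, hinfty, hφcont, hφmaps, hψcont, hψmaps, hψφ, hφψ⟩
  have hzU : z₀ ∉ U := by
    rw [hUopen.frontier_eq] at hz₀
    exact hz₀.2
  have hne : z₀ ≠ ∞ := fun e => hzU (e ▸ hinfty)
  obtain ⟨c, rfl⟩ := OnePoint.ne_infty_iff_exists.1 hne
  constructor
  · intro hlc ζ hζ _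
    exact h.forward hφhol hlc (mem_sphere_zero_iff_norm.1 hζ)
  · intro hsm
    exact h.backward hzU hsm

end
end

section
/- Let V ⊆ U be a domain (a nonempty connected open subset of U), let z₀ ∈ ∂U, and let ε > 0 be such that every point p ∈ ∂V ∩ U with p ∈ ℂ satisfies |p − z₀| > ε (points of ∂V ∩ U equal to ∞ are regarded as being at distance greater than ε from z₀). If two points w₁, w₂ ∈ V can be joined by a continuous curve γ contained in U that is disjoint from the closed disk {z ∈ ℂ : |z − z₀| ≤ ε}, then w₁ and w₂ can also be joined by a continuous curve contained in V that is disjoint from the closed disk {z ∈ ℂ : |z − z₀| ≤ ε}. -/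
open Filter Topology Metric Set OnePoint

noncomputable section

local notation "ℂ∞" => OnePoint ℂ

lemma aux_exp_const {X : Type*} [TopologicalSpace X] {S : Set X} (hS : IsPreconnected S)
    {d : X → ℂ} (hd : ContinuousOn d S) (he : ∀ x ∈ S, Complex.exp (d x) = 1)
    {x y : X} (hx : x ∈ S) (hy : y ∈ S) : d x = d y := by
  have hT : IsDiscrete (range ((↑) : ℤ → ℝ)) := by
    rw [isDiscrete_iff_discreteTopology]
    exact (Int.isClosedEmbedding_coe_real.isEmbedding.toHomeomorph).symm.isEmbedding.discreteTopology
  have key : ∀ x ∈ S, ∃ n : ℤ, d x = n * (2 * Real.pi * Complex.I) := fun x hx =>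
    Complex.exp_eq_one_iff.1 (he x hx)
  have him : ∀ x (n : ℤ), d x = n * (2 * Real.pi * Complex.I) → (d x).im / (2 * Real.pi) = n := by
    intro x n h
    rw [h]
    have := Real.pi_ne_zero
    simp
  have h := hS.constant_of_mapsTo hT (f := fun x => (d x).im / (2 * Real.pi))
    ((Complex.continuous_im.comp_continuousOn hd).div_const _)
    (by intro x hx
        obtain ⟨n, hn⟩ := key x hx
        exact ⟨n, (him x n hn).symm⟩) hx hy
  obtain ⟨n, hn⟩ := key x hx
  obtain ⟨m, hm⟩ := key y hy
  simp only [him x n hn, him y m hm] at h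
  rw [hn, hm]
  have : n = m := by exact_mod_cast h
  rw [this]

/-- continuous logarithm of `(z-p)/(z-q)` off `O`, vanishing at infinity -/
def LogRel (O : Set ℂ) (p q : ℂ) : Prop :=
  ∃ f : ℂ∞ → ℂ, ContinuousOn f (((↑) : ℂ → ℂ∞) '' O)ᶜ ∧ f ∞ = 0 ∧
    ∀ z : ℂ, z ∉ O → Complex.exp (f z) * (z - q) = z - p

lemma LogRel.symm {O : Set ℂ} {p q : ℂ} (h : LogRel O p q) : LogRel O q p := by
  obtain ⟨f, hf, h0, he⟩ := h
  refine ⟨fun z => - f z, hf.neg, by simp [h0], fun z hz => ?_⟩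
  rw [← he z hz, ← mul_assoc, ← Complex.exp_add]
  simp

lemma LogRel.trans {O : Set ℂ} {p q r : ℂ} (h : LogRel O p q) (h' : LogRel O q r) :
    LogRel O p r := by
  obtain ⟨f, hf, h0, he⟩ := h
  obtain ⟨f', hf', h0', he'⟩ := h'
  refine ⟨fun z => f z + f' z, hf.add hf', by simp [h0, h0'], fun z hz => ?_⟩
  rw [← he z hz, ← he' z hz, Complex.exp_add]
  ring

lemma tendsto_aux (a q : ℂ) : Tendsto (fun z : ℂ => a / (z - q)) (cocompact ℂ) (𝓝 0) := by
  have h1 : Tendsto (fun z : ℂ => z - q) (cocompact ℂ) (cocompact ℂ) := by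
    simpa using (Homeomorph.subRight q).isClosedEmbedding.tendsto_cocompact
  have h2 := (tendsto_inv₀_cobounded (α := ℂ)).comp (by rwa [← Metric.cobounded_eq_cocompact] at h1)
  have := h2.const_mul a
  rw [Metric.cobounded_eq_cocompact] at this
  simpa [div_eq_mul_inv] using this

lemma logRel_near {O : Set ℂ} (hO : IsOpen O) {p : ℂ} (hp : p ∈ O) :
    ∀ᶠ q in 𝓝 p, LogRel O q p := by
  obtain ⟨r, hr, hb⟩ := Metric.isOpen_iff.1 hO p hp
  filter_upwards [ball_mem_nhds p hr] with q hq
  have hz1 : ∀ z : ℂ, z ∉ O → ‖(p - q) / (z - p)‖ < 1 ∧ z - p ≠ 0 := by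
    intro z hz
    have h1 : r ≤ ‖z - p‖ := by
      by_contra h
      push Not at h
      exact hz (hb (by simpa [dist_eq_norm] using h))
    have h2 : ‖p - q‖ < r := by
      rw [mem_ball, dist_comm, dist_eq_norm] at hq; exact hq
    have h3 : 0 < ‖z - p‖ := by linarith
    refine ⟨?_, by simpa using h3⟩
    rw [norm_div, div_lt_one h3]
    linarith
  refine ⟨fun x => OnePoint.elim x (0 : ℂ) (fun z => Complex.log (1 + (p - q) / (z - p))), ?_, by simp, ?_⟩
  · intro x hx
    apply ContinuousAt.continuousWithinAt
    induction x using OnePoint.rec with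
    | infty =>
      rw [continuousAt_infty']
      simp only [coclosedCompact_eq_cocompact]
      have h := (tendsto_aux (p - q) p).const_add 1
      have h2 := (continuousAt_clog (x := 1 + 0) (by simp)).tendsto.comp h
      simpa [Function.comp_def] using h2
    | coe z =>
      have hz : z ∉ O := fun h => hx ⟨z, h, rfl⟩
      rw [continuousAt_coe]
      obtain ⟨h1, h2⟩ := hz1 z hz
      have := Complex.mem_slitPlane_of_norm_lt_one h1
      simp only [Function.comp_def, OnePoint.elim_some]
      refine ContinuousAt.clog ?_ this
      exact continuousAt_const.add (continuousAt_const.div (by fun_prop) h2)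
  · intro z hz
    obtain ⟨h1, h2⟩ := hz1 z hz
    have := Complex.slitPlane_ne_zero (Complex.mem_slitPlane_of_norm_lt_one h1)
    simp only [OnePoint.elim_some]
    rw [Complex.exp_log this]
    field_simp
    ring

lemma logRel_of_preconnected {O S : Set ℂ} (hO : IsOpen O) (hS : IsPreconnected S) (hSO : S ⊆ O)
    {p q : ℂ} (hp : p ∈ S) (hq : q ∈ S) : LogRel O p q := by
  refine hS.induction₂ (LogRel O) (fun x hx => ?_) (fun _ _ _ _ _ _ h h' => h.trans h')
    (fun _ _ _ _ h => h.symm) hp hq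
  exact ((logRel_near hO (hSO hx)).filter_mono nhdsWithin_le_nhds).mono fun _ h => h.symm

lemma logRel_inter {O₁ O₂ : Set ℂ} (h1 : IsOpen O₁) (h2 : IsOpen O₂) {p q : ℂ}
    (hq1 : q ∈ O₁)
    (hc : IsPreconnected (((↑) : ℂ → ℂ∞) '' (O₁ ∪ O₂))ᶜ)
    (hL1 : LogRel O₁ p q) (hL2 : LogRel O₂ p q) : LogRel (O₁ ∩ O₂) p q := by
  classical
  obtain ⟨f, hf, f0, fe⟩ := hL1
  obtain ⟨g, hg, g0, ge⟩ := hL2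
  have hinf : ∀ O : Set ℂ, (∞ : ℂ∞) ∈ (((↑) : ℂ → ℂ∞) '' O)ᶜ := by
    intro O; simp
  have heq : ∀ x ∈ (((↑) : ℂ → ℂ∞) '' (O₁ ∪ O₂))ᶜ, f x = g x := by
    intro x hx
    have hs1 : (((↑) : ℂ → ℂ∞) '' (O₁ ∪ O₂))ᶜ ⊆ (((↑) : ℂ → ℂ∞) '' O₁)ᶜ :=
      compl_subset_compl.2 (image_mono subset_union_left)
    have hs2 : (((↑) : ℂ → ℂ∞) '' (O₁ ∪ O₂))ᶜ ⊆ (((↑) : ℂ → ℂ∞) '' O₂)ᶜ :=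
      compl_subset_compl.2 (image_mono subset_union_right)
    have := aux_exp_const hc (d := fun x => f x - g x) ((hf.mono hs1).sub (hg.mono hs2)) (by
      intro y hy
      induction y using OnePoint.rec with
      | infty => simp [f0, g0]
      | coe z =>
        have hz1 : z ∉ O₁ := fun h => hs1 hy ⟨z, h, rfl⟩
        have hz2 : z ∉ O₂ := fun h => hs2 hy ⟨z, h, rfl⟩
        have hzq : z - q ≠ 0 := fun h => hz1 (by rw [sub_eq_zero.1 h]; exact hq1)
        have := (fe z hz1).trans (ge z hz2).symm
        rw [Complex.exp_sub, mul_right_cancel₀ hzq this]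
        exact div_self (Complex.exp_ne_zero _)) hx (hinf _)
    simpa [f0, g0, sub_eq_zero] using this
  have hcl : ∀ O : Set ℂ, IsOpen O → IsClosed (((↑) : ℂ → ℂ∞) '' O)ᶜ := fun O hO =>
    (isOpenEmbedding_coe.isOpenMap O hO).isClosed_compl
  let F : ℂ∞ → ℂ := fun x => if x ∈ (((↑) : ℂ → ℂ∞) '' O₁)ᶜ then f x else g x
  have hF1 : ∀ x ∈ (((↑) : ℂ → ℂ∞) '' O₁)ᶜ, F x = f x := fun x hx => if_pos hx
  have hF2 : ∀ x ∈ (((↑) : ℂ → ℂ∞) '' O₂)ᶜ, F x = g x := by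
    intro x hx
    by_cases h : x ∈ (((↑) : ℂ → ℂ∞) '' O₁)ᶜ
    · rw [hF1 x h]
      apply heq
      rw [image_union, compl_union]
      exact ⟨h, hx⟩
    · exact if_neg h
  refine ⟨F, ?_, ?_, ?_⟩
  · rw [image_inter coe_injective, compl_inter]
    exact (hf.congr hF1).union_of_isClosed (hg.congr hF2) (hcl _ h1) (hcl _ h2)
  · rw [hF1 _ (hinf _), f0]
  · intro z hz
    by_cases h : z ∈ O₁
    · have h' : z ∉ O₂ := fun h' => hz ⟨h, h'⟩
      rw [hF2 z (by simpa using h')]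
      exact ge z h'
    · rw [hF1 z (by simpa using h)]
      exact fe z h

lemma exists_log {g : ℂ → ℂ} (hg : Continuous g) (h0 : ∀ z, g z ≠ 0) :
    ∃ L : ℂ → ℂ, Continuous L ∧ ∀ z, Complex.exp (L z) = g z := by
  obtain ⟨L, ⟨-, hL⟩, -⟩ := Complex.isCoveringMapOn_exp.existsUnique_continuousMap_lifts
    (⟨g, hg⟩ : C(ℂ, ℂ)) (a₀ := 0) (e₀ := Complex.log (g 0)) (Complex.exp_log (h0 0)) (by simpa using h0)
  exact ⟨L, L.continuous, fun z => congrFun hL z⟩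

/-- no continuous nonvanishing function on the plane is asymptotic to `z - q`. -/
lemma no_asymp {g : ℂ → ℂ} (hg : Continuous g) (h0 : ∀ z, g z ≠ 0) (q : ℂ)
    (hlim : Tendsto (fun z => g z / (z - q)) (cocompact ℂ) (𝓝 1)) : False := by
  obtain ⟨L, hL, hLe⟩ := exists_log hg h0
  have hev : ∀ᶠ z in cocompact ℂ, g z / (z - q) ∈ Complex.slitPlane :=
    hlim.eventually (Complex.isOpen_slitPlane.mem_nhds (by simp))
  rw [← Metric.cobounded_eq_cocompact, (Metric.hasBasis_cobounded_compl_closedBall q).eventually_iff] at hev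
  obtain ⟨R, -, hR⟩ := hev
  set r : ℝ := max R 0 + 1 with hr
  have hr0 : 0 < r := by positivity
  have hrR : R < r := by have := le_max_left R 0; linarith
  let c : ℝ → ℂ := fun t => q + r * Complex.exp (t * Complex.I)
  have hcq : ∀ t, c t - q = r * Complex.exp (t * Complex.I) := fun t => by simp [c]
  have hcq0 : ∀ t, c t - q ≠ 0 := fun t => by
    rw [hcq]; exact mul_ne_zero (by exact_mod_cast hr0.ne') (Complex.exp_ne_zero _)
  have hcm : ∀ t, g (c t) / (c t - q) ∈ Complex.slitPlane := by
    intro t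
    apply hR
    simp only [mem_compl_iff, mem_closedBall, dist_eq_norm, hcq, norm_mul,
      Complex.norm_exp_ofReal_mul_I, Complex.norm_real, mul_one, Real.norm_eq_abs, abs_of_pos hr0]
    linarith
  have hcc : Continuous c := by fun_prop
  let l : ℝ → ℂ := fun t => L (c t) - Complex.log (g (c t) / (c t - q)) - t * Complex.I
  have hlc : Continuous l := by
    refine ((hL.comp hcc).sub ?_).sub (by fun_prop)
    refine Continuous.clog ?_ hcm
    exact (hg.comp hcc).div (hcc.sub continuous_const) hcq0
  have hle : ∀ t, Complex.exp (l t) = r := by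
    intro t
    simp only [l]
    rw [Complex.exp_sub, Complex.exp_sub, hLe, Complex.exp_log (Complex.slitPlane_ne_zero (hcm t)),
      div_div_cancel₀ (h0 _), hcq]
    exact mul_div_cancel_right₀ _ (Complex.exp_ne_zero _)
  have := aux_exp_const (S := univ) isPreconnected_univ (d := fun t => l t - l 0)
    (by fun_prop) (fun t _ => by
      rw [Complex.exp_sub, hle, hle]; exact div_self (by exact_mod_cast hr0.ne'))
      (mem_univ (2 * Real.pi)) (mem_univ 0)
  have hc2 : c (2 * Real.pi) = c 0 := by simp [c]
  simp [l, hc2, Real.pi_ne_zero] at this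

lemma frontier_comp {O : Set ℂ} (hO : IsOpen O) (p : ℂ) {z : ℂ}
    (hz : z ∈ frontier (connectedComponentIn O p)) : z ∉ O := by
  intro hzO
  have hop : IsOpen (connectedComponentIn O p) := hO.connectedComponentIn
  rw [hop.frontier_eq] at hz
  obtain ⟨y, hy1, hy2⟩ := mem_closure_iff.1 hz.1 _ hO.connectedComponentIn (mem_connectedComponentIn hzO)
  have e1 := connectedComponentIn_eq hy1
  have e2 := connectedComponentIn_eq hy2
  apply hz.2
  rw [e2, ← e1]
  exact mem_connectedComponentIn hzO

lemma mem_comp_of_logRel {O : Set ℂ} (hO : IsOpen O) {p q : ℂ} (hp : p ∈ O)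
    (h : LogRel O p q) : q ∈ connectedComponentIn O p := by
  classical
  by_contra hq
  obtain ⟨f, hf, f0, fe⟩ := h
  have hcl : IsClosed (((↑) : ℂ → ℂ∞) '' O)ᶜ := (isOpenEmbedding_coe.isOpenMap O hO).isClosed_compl
  obtain ⟨F, hF⟩ := ContinuousMap.exists_extension' hcl.isClosedEmbedding_subtypeVal
    ⟨_, hf.domRestrict⟩
  have hFf : ∀ x ∈ (((↑) : ℂ → ℂ∞) '' O)ᶜ, F x = f x := fun x hx => congrFun hF ⟨x, hx⟩
  set W := connectedComponentIn O p with hW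
  let g : ℂ → ℂ := fun z => if z ∈ W then Complex.exp (F z) * (z - q) else z - p
  have hFc : Continuous fun z : ℂ => F (z : ℂ∞) := F.continuous.comp continuous_coe
  have hgc : Continuous g := by
    refine Continuous.if ?_ ((Complex.continuous_exp.comp hFc).mul (by fun_prop)) (by fun_prop)
    intro z hz
    have hzO := frontier_comp hO p hz
    rw [hFf z (by simpa using hzO), fe z hzO]
  have hg0 : ∀ z, g z ≠ 0 := by
    intro z
    by_cases hz : z ∈ W
    · simp only [g, if_pos hz]
      refine mul_ne_zero (Complex.exp_ne_zero _) (sub_ne_zero.2 ?_)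
      rintro rfl; exact hq hz
    · simp only [g, if_neg hz]
      refine (sub_ne_zero.2 ?_)
      rintro rfl; exact hz (mem_connectedComponentIn hp)
  have hF0 : F ∞ = 0 := by rw [hFf _ (by simp), f0]
  have hlF : Tendsto (fun z : ℂ => Complex.exp (F z)) (cocompact ℂ) (𝓝 1) := by
    have := continuousAt_infty'.1 (F.continuous.continuousAt (x := ∞))
    rw [coclosedCompact_eq_cocompact, hF0] at this
    have := (Complex.continuous_exp.tendsto 0).comp this
    simpa [Function.comp_def] using this
  have hlp : Tendsto (fun z : ℂ => 1 + (q - p) / (z - q)) (cocompact ℂ) (𝓝 1) := by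
    simpa using (tendsto_aux (q - p) q).const_add 1
  have hne : ∀ᶠ z in cocompact ℂ, z ≠ q := by
    have : ({q} : Set ℂ)ᶜ ∈ cocompact ℂ := isCompact_singleton.compl_mem_cocompact
    filter_upwards [this] with z hz using hz
  refine no_asymp hgc hg0 q ?_
  refine ((hlF.mono_left inf_le_left).if (p := fun z => z ∈ W) (hlp.mono_left inf_le_left)).congr' ?_
  filter_upwards [hne] with z hz
  have hz' := sub_ne_zero.2 hz
  by_cases hzW : z ∈ W
  · simp only [g, if_pos hzW]
    field_simp
  · simp only [g, if_neg hzW]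
    field_simp
    ring

theorem janiszewski {O₁ O₂ S₁ S₂ : Set ℂ} (h1 : IsOpen O₁) (h2 : IsOpen O₂) {p q : ℂ}
    (hS1 : IsPreconnected S₁) (hS2 : IsPreconnected S₂) (hSO1 : S₁ ⊆ O₁) (hSO2 : S₂ ⊆ O₂)
    (hp1 : p ∈ S₁) (hq1 : q ∈ S₁) (hp2 : p ∈ S₂) (hq2 : q ∈ S₂)
    (hc : IsPreconnected (((↑) : ℂ → ℂ∞) '' (O₁ ∪ O₂))ᶜ) : JoinedIn (O₁ ∩ O₂) p q := by
  have hL := logRel_inter h1 h2 (hSO1 hq1) hc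
    (logRel_of_preconnected h1 hS1 hSO1 hp1 hq1) (logRel_of_preconnected h2 hS2 hSO2 hp2 hq2)
  have hO := h1.inter h2
  have hpO : p ∈ O₁ ∩ O₂ := ⟨hSO1 hp1, hSO2 hp2⟩
  have hm := mem_comp_of_logRel hO hpO hL
  have hcon : IsConnected (connectedComponentIn (O₁ ∩ O₂) p) :=
    isConnected_connectedComponentIn_iff.2 hpO
  have hpc := (hO.connectedComponentIn (x := p)).isConnected_iff_isPathConnected.1 hcon
  exact (hpc.joinedIn p (mem_connectedComponentIn hpO) q hm).mono (connectedComponentIn_subset _ _)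

open Classical in
/-- inversion on the sphere -/
def sphInv (x : ℂ∞) : ℂ∞ :=
  OnePoint.elim x ((0 : ℂ) : ℂ∞) (fun z : ℂ => if z = 0 then (∞ : ℂ∞) else ((z⁻¹ : ℂ) : ℂ∞))

lemma sphInv_invol (x : ℂ∞) : sphInv (sphInv x) = x := by
  induction x using OnePoint.rec with
  | infty => simp [sphInv]
  | coe z =>
    by_cases h : z = 0
    · simp [sphInv, h]
    · simp [sphInv, h]

lemma sphInv_cont : Continuous sphInv := by
  rw [OnePoint.continuous_iff]
  constructor
  · have h1 : Tendsto (fun z : ℂ => ((z⁻¹ : ℂ) : ℂ∞)) (cocompact ℂ) (𝓝 ((0 : ℂ) : ℂ∞)) := by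
      have := tendsto_inv₀_cobounded (α := ℂ)
      rw [Metric.cobounded_eq_cocompact] at this
      exact (continuous_coe.tendsto 0).comp this
    rw [coclosedCompact_eq_cocompact]
    refine h1.congr' ?_
    have : ({0} : Set ℂ)ᶜ ∈ cocompact ℂ := isCompact_singleton.compl_mem_cocompact
    filter_upwards [this] with z hz
    have hz' : z ≠ 0 := hz
    simp [sphInv, hz']
  · rw [continuous_iff_continuousAt]
    intro z
    by_cases hz : z = 0
    · subst hz
      rw [continuousAt_iff_punctured_nhds]
      have h1 : Tendsto (fun z : ℂ => ((z⁻¹ : ℂ) : ℂ∞)) (𝓝[≠] 0) (𝓝 ∞) := by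
        have := tendsto_inv₀_nhdsNE_zero (α := ℂ)
        rw [Metric.cobounded_eq_cocompact, ← coclosedCompact_eq_cocompact] at this
        refine Tendsto.comp ?_ this
        exact tendsto_coe_infty
      have : sphInv ((0 : ℂ) : ℂ∞) = ∞ := by simp [sphInv]
      rw [this]
      refine h1.congr' ?_
      filter_upwards [self_mem_nhdsWithin] with z hz
      have hz' : z ≠ 0 := hz
      simp [sphInv, hz']
    · have h1 : ContinuousAt (fun z : ℂ => ((z⁻¹ : ℂ) : ℂ∞)) z :=
        continuous_coe.continuousAt.comp (continuousAt_inv₀ hz)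
      refine h1.congr ?_
      filter_upwards [isOpen_ne.mem_nhds hz] with z hz
      have hz' : z ≠ 0 := hz
      simp [sphInv, hz']

def sphInvHomeo : ℂ∞ ≃ₜ ℂ∞ where
  toFun := sphInv
  invFun := sphInv
  left_inv := sphInv_invol
  right_inv := sphInv_invol
  continuous_toFun := sphInv_cont
  continuous_invFun := sphInv_cont

lemma exists_sph_homeo (z₀ : ℂ) : ∃ T : ℂ∞ ≃ₜ ℂ∞, T ∞ = (z₀ : ℂ∞) := by
  refine ⟨sphInvHomeo.trans (Homeomorph.addRight z₀).onePointCongr, ?_⟩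
  simp [sphInvHomeo, sphInv]

lemma conn_aux {U V D : Set ℂ∞} (hU : IsOpen U) (hVU : V ⊆ U) (hV : IsOpen V)
    (hK : IsConnected Uᶜ) (hD : IsPreconnected D) (hDc : IsClosed D) (hDK : (D ∩ Uᶜ).Nonempty)
    (hfar : ∀ p ∈ frontier V ∩ U, p ∉ D) : IsPreconnected ((U \ D) ∪ V)ᶜ := by
  have hKV : Uᶜ ⊆ ((U \ D) ∪ V)ᶜ := by
    rintro x hx (h | h)
    · exact hx h.1
    · exact hx (hVU h)
  have hcl : IsClosed ((U \ D) ∪ V)ᶜ := ((hU.sdiff hDc).union hV).isClosed_compl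
  rw [isPreconnected_iff_subset_of_fully_disjoint_closed hcl]
  have main : ∀ u v : Set ℂ∞, IsClosed u → IsClosed v → ((U \ D) ∪ V)ᶜ ⊆ u ∪ v → Disjoint u v →
      Uᶜ ⊆ u → ((U \ D) ∪ V)ᶜ ⊆ u := by
    intro u v hu hv huv hd hKu x hx
    rcases huv hx with h | hxv
    · exact h
    exfalso
    obtain ⟨z, hzD, hzK⟩ := hDK
    have hxU : x ∈ U := by
      by_contra h
      exact disjoint_left.1 hd (hKu h) hxv
    have hxD : x ∈ D := by
      by_contra h
      exact hx (Or.inl ⟨hxU, h⟩)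
    have hD' := isPreconnected_closed_iff.1 hD (((U \ D) ∪ V)ᶜ ∩ v)
      ((((U \ D) ∪ V)ᶜ ∩ u) ∪ closure V) (hcl.inter hv) ((hcl.inter hu).union isClosed_closure)
      (by
        intro y hy
        by_cases hyV : y ∈ V
        · exact Or.inr (Or.inr (subset_closure hyV))
        · have hyX : y ∈ ((U \ D) ∪ V)ᶜ := by
            rintro (h | h)
            · exact h.2 hy
            · exact hyV h
          rcases huv hyX with h | h
          · exact Or.inr (Or.inl ⟨hyX, h⟩)
          · exact Or.inl ⟨hyX, h⟩)
      ⟨x, hxD, hx, hxv⟩ ⟨z, hzD, Or.inl ⟨hKV hzK, hKu hzK⟩⟩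
    obtain ⟨y, hyD, ⟨hyX, hyv⟩, h | h⟩ := hD'
    · exact disjoint_left.1 hd h.2 hyv
    · have hyU : y ∈ U := by
        by_contra h
        exact disjoint_left.1 hd (hKu h) hyv
      refine hfar y ⟨?_, hyU⟩ hyD
      rw [hV.frontier_eq]
      exact ⟨h, fun hyV => hyX (Or.inr hyV)⟩
  intro u v hu hv huv hd
  rcases (isPreconnected_iff_subset_of_fully_disjoint_closed hU.isClosed_compl).1
    hK.isPreconnected u v hu hv (hKV.trans huv) hd with h | h
  · exact Or.inl (main u v hu hv huv hd h)
  · exact Or.inr (main v u hv hu (union_comm u v ▸ huv) hd.symm h)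

/-- Curves in a subdomain: if `∂V ∩ U` stays at distance `> ε` from `z₀`, then two points of
`V` joined in `U` avoiding the closed `ε`-disk can be joined inside `V` avoiding it. -/
theorem stmt4
    (U : Set ℂ∞) (hUopen : IsOpen U) (hUconn : IsConnected U)
    (hUsc : SimplyConnectedSpace U) (hinfty : ∞ ∈ U)
    (hKconn : IsConnected Uᶜ) (hKnt : Set.Nontrivial Uᶜ)
    (V : Set ℂ∞) (hVU : V ⊆ U) (hVopen : IsOpen V) (hVconn : IsConnected V)
    (z₀ : ℂ) (hz₀ : (z₀ : ℂ∞) ∈ frontier U)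
    (ε : ℝ) (hε : 0 < ε)
    (hfar : ∀ p ∈ frontier V ∩ U, ∀ x : ℂ, p = (x : ℂ∞) → ε < dist x z₀)
    (w₁ w₂ : ℂ∞) (hw₁ : w₁ ∈ V) (hw₂ : w₂ ∈ V)
    (γ : ℝ → ℂ∞) (hγcont : ContinuousOn γ (Icc 0 1))
    (hγ0 : γ 0 = w₁) (hγ1 : γ 1 = w₂)
    (hγmaps : MapsTo γ (Icc 0 1) (U \ ((fun c : ℂ => (c : ℂ∞)) '' closedBall z₀ ε))) :
    ∃ γ' : ℝ → ℂ∞, ContinuousOn γ' (Icc 0 1) ∧ γ' 0 = w₁ ∧ γ' 1 = w₂ ∧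
      MapsTo γ' (Icc 0 1) (V \ ((fun c : ℂ => (c : ℂ∞)) '' closedBall z₀ ε)) := by
  set D : Set ℂ∞ := (fun c : ℂ => (c : ℂ∞)) '' closedBall z₀ ε with hD
  obtain ⟨T, hT⟩ := exists_sph_homeo z₀
  have hzU : (z₀ : ℂ∞) ∉ U := by
    rw [hUopen.frontier_eq] at hz₀; exact hz₀.2
  have hDcomp : IsCompact D := (isCompact_closedBall z₀ ε).image continuous_coe
  have hDc : IsClosed D := hDcomp.isClosed
  have hDconn : IsPreconnected D :=
    (convex_closedBall z₀ ε).isPreconnected.image _ continuous_coe.continuousOn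
  have hconn := conn_aux hUopen hVU hVopen hKconn hDconn hDc
    ⟨z₀, ⟨z₀, mem_closedBall_self hε.le, rfl⟩, hzU⟩
    (by rintro p hp ⟨x, hx, rfl⟩
        exact absurd (mem_closedBall.1 hx) (not_le.2 (hfar _ hp x rfl)))
  let σ : ℂ → ℂ∞ := fun z => T z
  have hσc : Continuous σ := T.continuous.comp continuous_coe
  have hσo : IsOpenMap σ := T.isOpenMap.comp isOpenEmbedding_coe.isOpenMap
  have hσi : Function.Injective σ := T.injective.comp coe_injective
  have hσr : ∀ x ∈ U, x ∈ range σ := by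
    intro x hx
    obtain ⟨y, rfl⟩ := T.surjective x
    induction y using OnePoint.rec with
    | infty => rw [hT] at hx; exact absurd hx hzU
    | coe z => exact ⟨z, rfl⟩
  have hpre : ∀ S : Set ℂ∞, S ⊆ U → IsPreconnected S → IsPreconnected (σ ⁻¹' S) :=
    fun S hS hc => hc.preimage_of_isOpenMap hσi hσo fun x hx => hσr x (hS hx)
  obtain ⟨p, hp⟩ := hσr w₁ (hVU hw₁)
  obtain ⟨q, hq⟩ := hσr w₂ (hVU hw₂)
  have hγim : γ '' Icc 0 1 ⊆ U \ D := hγmaps.image_subset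
  have hJ : JoinedIn (σ ⁻¹' (U \ D) ∩ σ ⁻¹' V) p q := by
    refine janiszewski (S₁ := σ ⁻¹' (γ '' Icc 0 1)) (S₂ := σ ⁻¹' V)
      ((hUopen.sdiff hDc).preimage hσc) (hVopen.preimage hσc)
      (hpre _ (hγim.trans sdiff_subset) (isPreconnected_Icc.image _ hγcont))
      (hpre _ hVU hVconn.isPreconnected) (preimage_mono hγim) subset_rfl
      ⟨0, by simp, by rw [hγ0, hp]⟩ ⟨1, by simp, by rw [hγ1, hq]⟩
      (by rw [mem_preimage, hp]; exact hw₁) (by rw [mem_preimage, hq]; exact hw₂) ?_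
    have : (((↑) : ℂ → ℂ∞) '' (σ ⁻¹' (U \ D) ∪ σ ⁻¹' V))ᶜ = T.symm '' ((U \ D) ∪ V)ᶜ := by
      ext x
      rw [T.image_symm]
      induction x using OnePoint.rec with
      | infty =>
        simp only [mem_compl_iff, mem_preimage, hT]
        refine iff_of_true (by simp) ?_
        rintro (h | h)
        · exact hzU h.1
        · exact hzU (hVU h)
      | coe z =>
        rw [mem_compl_iff, coe_injective.mem_set_image]
        rfl
    rw [this]
    exact hconn.image _ T.symm.continuous.continuousOn
  obtain ⟨δ, hδ⟩ := hJ
  refine ⟨fun t => σ (δ.extend t), (hσc.comp δ.continuous_extend).continuousOn, ?_, ?_, ?_⟩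
  · simp [hp]
  · simp [hq]
  · intro t ht
    have := hδ ⟨t, ht⟩
    rw [← δ.extend_apply ht] at this
    exact ⟨this.2, this.1.2⟩

end
end
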